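/- arXiv:2402.00542 — 3 statements merged into one kernel-verified Lean document; each statement's English description precedes it below -/
import Mathlib

section
/- There is a constant K such that for every n ≥ 4 and every permutation σ of {1,…,n}, the formula rPar(n,σ) has a DRAT⁻ refutation, using no variables other than those of rPar(n,σ), with at most K·n·log n lines. -/
abbrev Lit (ν : Type) := ν × Bool
abbrev Clause (ν : Type) := Finset (ν × Bool)
abbrev CNF (ν : Type) := Finset (Finset (ν × Bool))

variable {ν : Type} [DecidableEq ν]

/-- Negation of a literal. -/
def negLit (l : Lit ν) : Lit ν := (l.1, !l.2)

/-- Canonical CNF encoding of the parity constraint `l₁ ⊕ ⋯ ⊕ l_k = c` for the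
literals in the list `ls`: the clauses forbid exactly the assignments under which
the number of true literals among `ls` has parity different from `c`. -/
def parityCNF (ls : List (Lit ν)) (c : Bool) : CNF ν :=
  ((Finset.univ : Finset (Fin ls.length → Bool)).filter
      (fun f => (Finset.univ.filter (fun i => f i = true)).card % 2 = (if c then 0 else 1))).image
    (fun f => Finset.univ.image (fun i => if f i then negLit (ls.get i) else ls.get i))

/-- `xor(l₁,…,l_k)`: canonical CNF encoding of `l₁ ⊕ ⋯ ⊕ l_k = 0`. -/
def xorCNF (ls : List (Lit ν)) : CNF ν := parityCNF ls false

def clauseSat (τ : ν → Bool) (C : Clause ν) : Prop := ∃ l ∈ C, τ l.1 = l.2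

def cnfSat (τ : ν → Bool) (F : CNF ν) : Prop := ∀ C ∈ F, clauseSat τ C

def Unsat (F : CNF ν) : Prop := ¬ ∃ τ : ν → Bool, cnfSat τ F

def cnfVars (F : CNF ν) : Set ν := {v | ∃ C ∈ F, ∃ b, (v, b) ∈ C}

def clauseVars (C : Clause ν) : Set ν := {v | ∃ b, (v, b) ∈ C}

/-- `R` is the resolvent of `C` and `D`. -/
def IsResolvent (C D R : Clause ν) : Prop :=
  ∃ v : ν, (v, true) ∈ C ∧ (v, false) ∈ D ∧ R = C.erase (v, true) ∪ D.erase (v, false)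

/-- A resolution refutation of `F`: a sequence of clauses, each an axiom of `F` or a
resolvent of two earlier clauses, ending with the empty clause. Its length is `L.length`. -/
def IsResRefutation (F : CNF ν) (L : List (Clause ν)) : Prop :=
  L ≠ [] ∧ L.getLast? = some (∅ : Clause ν) ∧
    ∀ i, (hi : i < L.length) →
      L[i] ∈ F ∨ ∃ j k, ∃ (hj : j < i) (hk : k < i),
        IsResolvent (L[j]'(hj.trans hi)) (L[k]'(hk.trans hi)) L[i]

/-- The `j`-th xor constraint (0-based) of `Parity(xs, t)`: for a list `xs` of `n ≥ 4`
literals and Tseitin variables `t 0, …, t (n-4)`, constraint `0` is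
`xor(xs[0], xs[1], t 0)`, constraint `j` for `1 ≤ j ≤ n-4` is
`xor(t (j-1), xs[j+1], t j)`, and constraint `n-3` is `xor(t (n-4), xs[n-2], xs[n-1])`. -/
def parityCtr (xs : List (Lit ν)) (t : ℕ → ν) (j : ℕ) : List (Lit ν) :=
  if j = 0 then [xs.getD 0 (t 0, true), xs.getD 1 (t 0, true), (t 0, true)]
  else if j < xs.length - 3 then [(t (j - 1), true), xs.getD (j + 1) (t 0, true), (t j, true)]
  else [(t (xs.length - 4), true), xs.getD (xs.length - 2) (t 0, true),
    xs.getD (xs.length - 1) (t 0, true)]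

/-- The standard linear CNF encoding `Parity(xs, t)` of the parity constraint
`xs[0] ⊕ ⋯ ⊕ xs[n-1] = 0` using Tseitin variables `t 0, …, t (n-4)`. -/
def ParityCNF (xs : List (Lit ν)) (t : ℕ → ν) : CNF ν :=
  (Finset.range (xs.length - 2)).biUnion (fun j => xorCNF (parityCtr xs t j))

/-- The list of literals `x_0, …, x_{n-1}` (all positive), variable `x_i` encoded as `i : ℕ`. -/
def xListA (n : ℕ) : List (Lit ℕ) := List.ofFn (fun i : Fin n => ((i : ℕ), true))

/-- The list of literals `X'_{σ(0)}, …, X'_{σ(n-1)}` where `X' = (x_0, …, x_{n-2}, ¬x_{n-1})`. -/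
def xListB (n : ℕ) (σ : Equiv.Perm (Fin n)) : List (Lit ℕ) :=
  List.ofFn (fun i : Fin n => (((σ i) : ℕ), decide (((σ i) : ℕ) ≠ n - 1)))

/-- `rPar(n, σ) = Parity(X, S, id) ∧ Parity(X', T, σ)`; the variables `x_i` are encoded
as `i`, the Tseitin variables `S` as `n + k` and `T` as `2n + k`. -/
def rPar (n : ℕ) (σ : Equiv.Perm (Fin n)) : CNF ℕ :=
  ParityCNF (xListA n) (fun k => n + k) ∪ ParityCNF (xListB n σ) (fun k => 2 * n + k)

/-- The CNF `¬C` consisting of the unit clauses negating the literals of `C`. -/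
def clauseNegCNF (C : Clause ν) : CNF ν := C.image (fun l => ({negLit l} : Clause ν))

/-- One step of unit propagation: pick a unit clause `{l}` of `F`, resolve it with every
clause of `F` containing the negation of `l`, then remove `{l}`. -/
def UPStep (F F' : CNF ν) : Prop :=
  ∃ l : Lit ν, ({l} : Clause ν) ∈ F ∧
    F' = (F.erase {l}) ∪
      (F.filter (fun C => negLit l ∈ C)).image (fun C => C.erase (negLit l))

/-- `F ⊢₁ ⊥`: unit propagation from `F` derives the empty clause. -/
def UPRefutes (F : CNF ν) : Prop :=
  ∃ F', Relation.ReflTransGen UPStep F F' ∧ (∅ : Clause ν) ∈ F'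

/-- `C` is an asymmetric tautology (AT) w.r.t. `F`: `F ∧ ¬C ⊢₁ ⊥`. -/
def IsAT (F : CNF ν) (C : Clause ν) : Prop := UPRefutes (F ∪ clauseNegCNF C)

/-- `C` is a resolution asymmetric tautology (RAT) w.r.t. `F`. -/
def IsRAT (F : CNF ν) (C : Clause ν) : Prop :=
  ∃ l ∈ C, ∀ D ∈ F, negLit l ∈ D →
    UPRefutes (F ∪ clauseNegCNF (D.erase (negLit l)) ∪ clauseNegCNF C)

/-- A DRAT step: add a clause that is AT or RAT w.r.t. the current formula, or delete a
clause that is AT or RAT w.r.t. the remaining formula. -/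
def DRATStep (F F' : CNF ν) : Prop :=
  (∃ C : Clause ν, (IsAT F C ∨ IsRAT F C) ∧ F' = insert C F) ∨
  (∃ C ∈ F, (IsAT (F.erase C) C ∨ IsRAT (F.erase C) C) ∧ F' = F.erase C)

/-- A DRAT refutation of `F`: a sequence of formulas starting at `F`, linked by DRAT
steps, whose final formula contains the empty clause. Its number of lines is
`Fs.length - 1` (the number of steps). -/
def IsDRATRefutation (F : CNF ν) (Fs : List (CNF ν)) : Prop :=
  Fs ≠ [] ∧ List.Chain' DRATStep Fs ∧ Fs.head? = some F ∧
    ∃ G, Fs.getLast? = some G ∧ (∅ : Clause ν) ∈ G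

/-- The derivation `Fs` uses no variables other than those of `F` (DRAT⁻ condition). -/
def NoNewVars (F : CNF ν) (Fs : List (CNF ν)) : Prop :=
  ∀ G ∈ Fs, cnfVars G ⊆ cnfVars F

set_option linter.unusedSectionVars false
set_option linter.unusedSimpArgs false

/-! ### Unit propagation -/

/-- Clauses derivable by (non-destructive) unit resolution. -/
inductive UPD (F : CNF ν) : Clause ν → Prop
  | base {C : Clause ν} : C ∈ F → UPD F C
  | step {l : Lit ν} {C : Clause ν} : UPD F {l} → UPD F C → UPD F (C.erase (negLit l))

theorem negLit_negLit (l : Lit ν) : negLit (negLit l) = l := by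
  simp [negLit]

theorem negLit_ne (l : Lit ν) : negLit l ≠ l := by
  intro h
  have := congrArg Prod.snd h
  simp [negLit] at this

theorem negLit_inj {l m : Lit ν} (h : negLit l = negLit m) : l = m := by
  rw [← negLit_negLit l, h, negLit_negLit]

theorem UPD.mono {F G : CNF ν} (h : F ⊆ G) {C : Clause ν} (hC : UPD F C) : UPD G C := by
  induction hC with
  | base h' => exact .base (h h')
  | step _ _ ih1 ih2 => exact .step ih1 ih2

theorem UPRefutes.mono {F G : CNF ν} (h : F ⊆ G) (hF : UPRefutes F) : UPRefutes G := by
  obtain ⟨F', hs, he⟩ := hF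
  induction hs using Relation.ReflTransGen.head_induction_on generalizing G with
  | refl => exact ⟨G, .refl, h he⟩
  | head h1 _ ih =>
    obtain ⟨l, hl, rfl⟩ := h1
    obtain ⟨G', h2, h3⟩ := @ih ((G.erase {l}) ∪
      (G.filter (fun C => negLit l ∈ C)).image (fun C => C.erase (negLit l))) (by
        apply Finset.union_subset_union
        · exact Finset.erase_subset_erase _ h
        · exact Finset.image_subset_image (Finset.filter_subset_filter _ h))
    exact ⟨G', .head ⟨l, h hl, rfl⟩ h2, h3⟩

theorem UPD.exists_unit {F : CNF ν} {C : Clause ν} (h : UPD F C) :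
    C ∈ F ∨ ∃ l : Lit ν, ({l} : Clause ν) ∈ F := by
  induction h with
  | base h => exact .inl h
  | step _ _ ih1 ih2 =>
    rcases ih1 with h | h
    · exact .inr ⟨_, h⟩
    · exact .inr h

/-- Assign `l` and drop every clause mentioning its variable. -/
def reduce (G : CNF ν) (l : Lit ν) : CNF ν :=
  (G.filter (fun C => l ∉ C)).image (fun C => C.erase (negLit l))

theorem UPD.reduce {G : CNF ν} (l : Lit ν) {C : Clause ν} (h : UPD G C) :
    l ∈ C ∨ ∃ C', C' ⊆ C.erase (negLit l) ∧ UPD (reduce G l) C' := by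
  induction h with
  | @base C h =>
    by_cases hl : l ∈ C
    · exact .inl hl
    · refine .inr ⟨C.erase (negLit l), subset_rfl, .base ?_⟩
      exact Finset.mem_image.2 ⟨C, Finset.mem_filter.2 ⟨h, hl⟩, rfl⟩
  | @step m C _ _ ih1 ih2 =>
    rcases ih1 with h | ⟨C', hC', hU⟩
    · have hm : l = m := by simpa using h
      subst hm
      rcases ih2 with h | ⟨C2, h2, hU2⟩
      · exact .inl (Finset.mem_erase.2 ⟨(negLit_ne l).symm, h⟩)
      · exact .inr ⟨C2, by simpa using h2, hU2⟩
    · by_cases he : C' = ∅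
      · subst he
        exact .inr ⟨∅, by simp, hU⟩
      · obtain ⟨x, hx⟩ := Finset.nonempty_iff_ne_empty.2 he
        have hx' := hC' hx
        simp only [Finset.mem_erase, Finset.mem_singleton] at hx'
        obtain ⟨hx1, rfl⟩ := hx'
        have hCe : C' = {x} := by
          apply Finset.Subset.antisymm
          · exact hC'.trans (Finset.erase_subset _ _)
          · simpa using hx
        subst hCe
        rcases ih2 with h | ⟨C2, h2, hU2⟩
        · refine .inl (Finset.mem_erase.2 ⟨?_, h⟩)
          rintro rfl
          exact hx1 (negLit_negLit x).symm
        · refine .inr ⟨C2.erase (negLit x), ?_, .step hU hU2⟩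
          rw [Finset.erase_right_comm]
          exact Finset.erase_subset_erase _ h2

theorem UPRefutes_of_UPD (N : ℕ) : ∀ (F : CNF ν),
    (F.biUnion (fun C => C.image Prod.fst)).card ≤ N → UPD F ∅ → UPRefutes F := by
  induction N with
  | zero =>
    intro F hF h
    rcases h.exists_unit with h | ⟨l, hl⟩
    · exact ⟨F, .refl, h⟩
    · exfalso
      have : l.1 ∈ F.biUnion (fun C => C.image Prod.fst) := by
        simp only [Finset.mem_biUnion, Finset.mem_image]
        exact ⟨_, hl, l, by simp, rfl⟩
      have := Finset.card_pos.2 ⟨_, this⟩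
      omega
  | succ N ih =>
    intro F hF h
    rcases h.exists_unit with h' | ⟨l, hl⟩
    · exact ⟨F, .refl, h'⟩
    · have hr : UPRefutes (reduce F l) := by
        apply ih
        · have hlt : ((reduce F l).biUnion (fun C => C.image Prod.fst)) ⊂
              (F.biUnion (fun C => C.image Prod.fst)) := by
            rw [Finset.ssubset_iff_of_subset]
            · refine ⟨l.1, ?_, ?_⟩
              · simp only [Finset.mem_biUnion, Finset.mem_image]
                exact ⟨_, hl, l, by simp, rfl⟩
              · simp only [Finset.mem_biUnion, Finset.mem_image, _root_.reduce, Finset.mem_filter]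
                rintro ⟨C, ⟨D, ⟨hD, hlD⟩, rfl⟩, m, hm, hml⟩
                rw [Finset.mem_erase] at hm
                obtain ⟨m1, m2⟩ := m
                obtain ⟨l1, l2⟩ := l
                simp only at hml
                subst hml
                by_cases h12 : m2 = l2
                · subst h12; exact hlD hm.2
                · apply hm.1
                  simp only [negLit, Prod.mk.injEq, true_and]
                  revert h12; cases m2 <;> cases l2 <;> simp
            · intro v
              simp only [Finset.mem_biUnion, Finset.mem_image, _root_.reduce, Finset.mem_filter]
              rintro ⟨C, ⟨D, ⟨hD, hlD⟩, rfl⟩, m, hm, hml⟩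
              exact ⟨D, hD, m, (Finset.mem_erase.1 hm).2, hml⟩
          have := Finset.card_lt_card hlt
          omega
        · rcases h.reduce l with h | ⟨C', hC', hU⟩
          · simp at h
          · have : C' = ∅ := by simpa using hC'
            exact this ▸ hU
      have hr' := UPRefutes.mono (G := (F.erase {l}) ∪
        (F.filter (fun C => negLit l ∈ C)).image (fun C => C.erase (negLit l))) (by
          intro C hC
          simp only [_root_.reduce, Finset.mem_image, Finset.mem_filter] at hC
          obtain ⟨D, ⟨hD, hlD⟩, rfl⟩ := hC
          by_cases hn : negLit l ∈ D
          · exact Finset.mem_union_right _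
              (Finset.mem_image.2 ⟨D, Finset.mem_filter.2 ⟨hD, hn⟩, rfl⟩)
          · rw [Finset.erase_eq_of_notMem hn]
            refine Finset.mem_union_left _ (Finset.mem_erase.2 ⟨?_, hD⟩)
            rintro rfl
            simp at hlD) hr
      obtain ⟨G, h1, h2⟩ := hr'
      exact ⟨G, .head ⟨l, hl, rfl⟩ h1, h2⟩

theorem UPD.refutes {F : CNF ν} (h : UPD F ∅) : UPRefutes F :=
  UPRefutes_of_UPD _ F le_rfl h

/-! ### Propagating values -/

def lxor (l : Lit ν) (b : Bool) : Lit ν := (l.1, xor l.2 b)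

theorem negLit_lxor (l : Lit ν) (b : Bool) : negLit (lxor l b) = lxor l (!b) := by
  simp [negLit, lxor]

def Prov (F : CNF ν) (l : Lit ν) : Prop := UPD F {l} ∨ UPD F ∅

theorem Prov.contra {F : CNF ν} {l : Lit ν} (h1 : Prov F l) (h2 : Prov F (negLit l)) :
    UPD F ∅ := by
  rcases h1 with h1 | h1
  · rcases h2 with h2 | h2
    · have := UPD.step h1 h2
      simpa using this
    · exact h2
  · exact h1

theorem UPD.sdiff {F : CNF ν} {D : Clause ν} (hD : UPD F D) (S : Clause ν)
    (hS : ∀ l ∈ S, UPD F {negLit l}) : UPD F (D \ S) := by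
  induction S using Finset.induction_on with
  | empty => simpa using hD
  | insert a S _ ih =>
    have h1 := ih (fun l hl => hS l (Finset.mem_insert_of_mem hl))
    have h2 := UPD.step (hS a (Finset.mem_insert_self _ _)) h1
    rw [negLit_negLit] at h2
    rwa [Finset.sdiff_insert]

theorem Prov.clause {F : CNF ν} {D : Clause ν} {x : Lit ν} (hD : D ∈ F)
    (h : ∀ l ∈ D, l = x ∨ Prov F (negLit l)) : Prov F x := by
  by_cases he : UPD F ∅
  · exact .inr he
  have h1 := (UPD.base hD).sdiff (D.erase x) (by
    intro l hl
    rw [Finset.mem_erase] at hl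
    rcases h l hl.2 with h | h | h
    · exact absurd h hl.1
    · exact h
    · exact absurd h he)
  by_cases hx : x ∈ D
  · left
    rwa [Finset.sdiff_erase_self hx] at h1
  · right
    rwa [Finset.erase_eq_of_notMem hx, Finset.sdiff_self] at h1

/-- Unit propagation shows that literal `a` has value `α`. -/
def Holds (F : CNF ν) (a : Lit ν) (α : Bool) : Prop := Prov F (lxor a (!α))

theorem Holds.contra {F : CNF ν} {a : Lit ν} {α β : Bool} (h1 : Holds F a α) (h2 : Holds F a β)
    (h : α ≠ β) : UPD F ∅ := by
  have : β = !α := by cases α <;> cases β <;> simp_all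
  subst this
  apply Prov.contra h1
  rw [negLit_lxor]
  exact h2

theorem Holds.of_mem {F : CNF ν} {C : Clause ν} {a : Lit ν} {i : Bool}
    (hF : clauseNegCNF C ⊆ F) (h : lxor a i ∈ C) : Holds F a i := by
  left
  apply UPD.base
  apply hF
  simp only [clauseNegCNF, Finset.mem_image]
  exact ⟨_, h, by rw [negLit_lxor]⟩

/-! ### Xor constraints -/

def X3 (a b c : Lit ν) : CNF ν :=
  (Finset.univ : Finset (Bool × Bool)).image
    (fun p => {lxor a p.1, lxor b p.2, lxor c (!(xor p.1 p.2))})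

def X4 (a b c d : Lit ν) : CNF ν :=
  (Finset.univ : Finset (Bool × Bool × Bool)).image
    (fun p => {lxor a p.1, lxor b p.2.1, lxor c p.2.2, lxor d (!(xor (xor p.1 p.2.1) p.2.2))})

/-- Weakenings of `X3 a b c` by a literal of `d`. -/
def Y4 (a b c d : Lit ν) : CNF ν :=
  (Finset.univ : Finset (Bool × Bool × Bool)).image
    (fun p => {lxor a p.1, lxor b p.2.1, lxor c (!(xor p.1 p.2.1)), lxor d p.2.2})

theorem mem_X3 {a b c : Lit ν} {C : Clause ν} : C ∈ X3 a b c ↔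
    ∃ i j, C = {lxor a i, lxor b j, lxor c (!(xor i j))} := by
  simp only [X3, Finset.mem_image, Finset.mem_univ, true_and, Prod.exists]
  exact ⟨fun ⟨i, j, h⟩ => ⟨i, j, h.symm⟩, fun ⟨i, j, h⟩ => ⟨i, j, h.symm⟩⟩

theorem mem_X4 {a b c d : Lit ν} {C : Clause ν} : C ∈ X4 a b c d ↔
    ∃ i j k, C = {lxor a i, lxor b j, lxor c k, lxor d (!(xor (xor i j) k))} := by
  simp only [X4, Finset.mem_image, Finset.mem_univ, true_and, Prod.exists]
  exact ⟨fun ⟨i, j, k, h⟩ => ⟨i, j, k, h.symm⟩, fun ⟨i, j, k, h⟩ => ⟨i, j, k, h.symm⟩⟩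

theorem mem_Y4 {a b c d : Lit ν} {C : Clause ν} : C ∈ Y4 a b c d ↔
    ∃ i j k, C = {lxor a i, lxor b j, lxor c (!(xor i j)), lxor d k} := by
  simp only [Y4, Finset.mem_image, Finset.mem_univ, true_and, Prod.exists]
  exact ⟨fun ⟨i, j, k, h⟩ => ⟨i, j, k, h.symm⟩, fun ⟨i, j, k, h⟩ => ⟨i, j, k, h.symm⟩⟩

theorem X3_card (a b c : Lit ν) : (X3 a b c).card ≤ 4 := Finset.card_image_le.trans (by simp)
theorem X4_card (a b c d : Lit ν) : (X4 a b c d).card ≤ 8 := Finset.card_image_le.trans (by simp)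
theorem Y4_card (a b c d : Lit ν) : (Y4 a b c d).card ≤ 8 := Finset.card_image_le.trans (by simp)

theorem X3_swap12 (a b c : Lit ν) : X3 a b c = X3 b a c := by
  ext C
  rw [mem_X3, mem_X3]
  constructor <;> rintro ⟨i, j, rfl⟩ <;> refine ⟨j, i, ?_⟩ <;>
    rw [Bool.xor_comm i j, Finset.insert_comm]

theorem X3_swap23 (a b c : Lit ν) : X3 a b c = X3 a c b := by
  ext C
  rw [mem_X3, mem_X3]
  constructor <;> rintro ⟨i, j, rfl⟩ <;> refine ⟨i, !(xor i j), ?_⟩ <;>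
    rw [Finset.pair_comm] <;> cases i <;> cases j <;> rfl

theorem X4_rot (a b c d : Lit ν) : X4 a b c d = X4 b c a d := by
  ext C
  rw [mem_X4, mem_X4]
  constructor
  · rintro ⟨i, j, k, rfl⟩
    refine ⟨j, k, i, ?_⟩
    rw [show (xor (xor j k) i) = (xor (xor i j) k) by cases i <;> cases j <;> cases k <;> rfl]
    ext x; simp only [Finset.mem_insert, Finset.mem_singleton]; tauto
  · rintro ⟨j, k, i, rfl⟩
    refine ⟨i, j, k, ?_⟩
    rw [show (xor (xor j k) i) = (xor (xor i j) k) by cases i <;> cases j <;> cases k <;> rfl]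
    ext x; simp only [Finset.mem_insert, Finset.mem_singleton]; tauto

theorem Holds.x3 {F : CNF ν} {a b c : Lit ν} {α β : Bool} (h : X3 a b c ⊆ F)
    (ha : Holds F a α) (hb : Holds F b β) : Holds F c (xor α β) := by
  refine Prov.clause (h (mem_X3.2 ⟨α, β, rfl⟩)) ?_
  intro l hl
  simp only [Finset.mem_insert, Finset.mem_singleton] at hl
  rcases hl with rfl | rfl | rfl
  · right; rw [negLit_lxor]; exact ha
  · right; rw [negLit_lxor]; exact hb
  · left; rfl

theorem Holds.x4 {F : CNF ν} {a b c d : Lit ν} {α β γ : Bool} (h : X4 a b c d ⊆ F)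
    (ha : Holds F a α) (hb : Holds F b β) (hc : Holds F c γ) :
    Holds F d (xor (xor α β) γ) := by
  refine Prov.clause (h (mem_X4.2 ⟨α, β, γ, rfl⟩)) ?_
  intro l hl
  simp only [Finset.mem_insert, Finset.mem_singleton] at hl
  rcases hl with rfl | rfl | rfl | rfl
  · right; rw [negLit_lxor]; exact ha
  · right; rw [negLit_lxor]; exact hb
  · right; rw [negLit_lxor]; exact hc
  · left; rfl

theorem IsAT.mono {F G : CNF ν} (h : F ⊆ G) {C : Clause ν} (hF : IsAT F C) : IsAT G C :=
  UPRefutes.mono (Finset.union_subset_union_left h) hF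

theorem at_X4 {F : CNF ν} {a b c o t : Lit ν} (h1 : X3 a b t ⊆ F) (h2 : X3 t c o ⊆ F)
    {C : Clause ν} (hC : C ∈ X4 a b c o) : IsAT F C := by
  obtain ⟨i, j, k, rfl⟩ := mem_X4.1 hC
  apply UPD.refutes
  have hs := @Finset.subset_union_right _ _ F (clauseNegCNF
    {lxor a i, lxor b j, lxor c k, lxor o (!(xor (xor i j) k))})
  have ha := Holds.of_mem (a := a) (i := i) hs (by simp)
  have hb := Holds.of_mem (a := b) (i := j) hs (by simp)
  have hc := Holds.of_mem (a := c) (i := k) hs (by simp)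
  have ho := Holds.of_mem (a := o) (i := !(xor (xor i j) k)) hs (by simp)
  have ht := Holds.x3 (h1.trans Finset.subset_union_left) ha hb
  have ho' := Holds.x3 (h2.trans Finset.subset_union_left) ht hc
  exact ho.contra ho' (by simp)

theorem at_Y4 {F : CNF ν} {a b c o t : Lit ν} (h1 : X3 a b t ⊆ F) (h2 : X4 a b c o ⊆ F)
    {C : Clause ν} (hC : C ∈ Y4 t c o a) : IsAT F C := by
  obtain ⟨i, j, k, rfl⟩ := mem_Y4.1 hC
  apply UPD.refutes
  have hs := @Finset.subset_union_right _ _ F (clauseNegCNF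
    {lxor t i, lxor c j, lxor o (!(xor i j)), lxor a k})
  have ht := Holds.of_mem (a := t) (i := i) hs (by simp)
  have hc := Holds.of_mem (a := c) (i := j) hs (by simp)
  have ho := Holds.of_mem (a := o) (i := !(xor i j)) hs (by simp)
  have ha := Holds.of_mem (a := a) (i := k) hs (by simp)
  rw [X3_swap23] at h1
  have hb := Holds.x3 (h1.trans Finset.subset_union_left) ha ht
  have ho' := Holds.x4 (h2.trans Finset.subset_union_left) ha hb hc
  exact ho.contra ho' (by cases i <;> cases j <;> cases k <;> simp)

theorem at_X3_of_Y4 {F : CNF ν} {a b c d : Lit ν} (h1 : Y4 a b c d ⊆ F)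
    {C : Clause ν} (hC : C ∈ X3 a b c) : IsAT F C := by
  obtain ⟨i, j, rfl⟩ := mem_X3.1 hC
  apply UPD.refutes
  have hs := @Finset.subset_union_right _ _ F (clauseNegCNF
    {lxor a i, lxor b j, lxor c (!(xor i j))})
  have ha := Holds.of_mem (a := a) (i := i) hs (by simp)
  have hb := Holds.of_mem (a := b) (i := j) hs (by simp)
  have hc := Holds.of_mem (a := c) (i := !(xor i j)) hs (by simp)
  have hd : ∀ k, Holds (F ∪ clauseNegCNF {lxor a i, lxor b j, lxor c (!(xor i j))}) d (!k) := by
    intro k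
    refine Prov.clause (Finset.mem_union_left _ (h1 (mem_Y4.2 ⟨i, j, k, rfl⟩))) ?_
    intro l hl
    simp only [Finset.mem_insert, Finset.mem_singleton] at hl
    rcases hl with rfl | rfl | rfl | rfl
    · right; rw [negLit_lxor]; exact ha
    · right; rw [negLit_lxor]; exact hb
    · right; rw [negLit_lxor]; exact hc
    · left; simp
  exact (hd true).contra (hd false) (by simp)

theorem rat_X3 {F : CNF ν} {a b t : Lit ν} (hat : a.1 ≠ t.1) (hbt : b.1 ≠ t.1)
    (hF : ∀ D ∈ F, ∀ k, (t.1, k) ∈ D → D ∈ X3 a b t)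
    {C : Clause ν} (hC : C ∈ X3 a b t) : IsRAT F C := by
  obtain ⟨i, j, rfl⟩ := mem_X3.1 hC
  refine ⟨lxor t (!(xor i j)), by simp, ?_⟩
  intro D hD hl
  rw [negLit_lxor, Bool.not_not] at hl ⊢
  obtain ⟨i', j', rfl⟩ := mem_X3.1 (hF D hD _ hl)
  apply UPD.refutes
  set C : Clause ν := {lxor a i, lxor b j, lxor t (!(xor i j))} with hCdef
  set D : Clause ν := {lxor a i', lxor b j', lxor t (!(xor i' j'))} with hDdef
  set G := F ∪ clauseNegCNF (D.erase (lxor t (xor i j))) ∪ clauseNegCNF C with hG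
  have hs1 : clauseNegCNF C ⊆ G := Finset.subset_union_right
  have hs2 : clauseNegCNF (D.erase (lxor t (xor i j))) ⊆ G :=
    Finset.subset_union_right.trans Finset.subset_union_left
  have ha := Holds.of_mem (a := a) (i := i) hs1 (by simp [hCdef])
  have hb := Holds.of_mem (a := b) (i := j) hs1 (by simp [hCdef])
  have ha' := Holds.of_mem (a := a) (i := i') hs2 (by
    simp only [hDdef, Finset.mem_erase, Finset.mem_insert, true_or, and_true]
    intro h
    have h' := congrArg Prod.fst h
    exact hat h')
  have hb' := Holds.of_mem (a := b) (i := j') hs2 (by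
    simp only [hDdef, Finset.mem_erase, Finset.mem_insert, true_or, or_true, and_true]
    intro h
    have h' := congrArg Prod.fst h
    exact hbt h')
  have hk : xor i j = !(xor i' j') := by
    simp only [hDdef, Finset.mem_insert, Finset.mem_singleton] at hl
    rcases hl with h | h | h
    · exact absurd (congrArg Prod.fst h).symm hat
    · exact absurd (congrArg Prod.fst h).symm hbt
    · have := congrArg Prod.snd h
      simp only [lxor] at this
      exact Bool.xor_right_inj.1 this
  by_cases hi : i = i'
  · refine hb.contra hb' ?_
    subst hi
    revert hk; cases i <;> cases j <;> cases j' <;> simp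
  · exact ha.contra ha' hi

/-! ### DRAT reachability -/

inductive Reach (V : Set ν) : ℕ → CNF ν → CNF ν → Prop
  | refl (k : ℕ) (F : CNF ν) : Reach V k F F
  | step {k : ℕ} {F G H : CNF ν} : DRATStep F G → cnfVars G ⊆ V → Reach V k G H →
      Reach V (k + 1) F H

theorem Reach.trans {V : Set ν} {k m : ℕ} {F G H : CNF ν} (h1 : Reach V k F G)
    (h2 : Reach V m G H) : Reach V (k + m) F H := by
  induction h1 with
  | refl k F =>
    induction h2 generalizing k with
    | refl m F => exact .refl _ _
    | step h hv _ ih => exact .step h hv (ih k)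
  | step h hv _ ih =>
    rw [Nat.add_right_comm]
    exact .step h hv (ih h2)

theorem Reach.mono {V : Set ν} {k m : ℕ} {F G : CNF ν} (h1 : Reach V k F G) (h : k ≤ m) :
    Reach V m F G := by
  obtain ⟨d, rfl⟩ := Nat.exists_eq_add_of_le h
  exact h1.trans (.refl d G)

theorem Reach.vars {V : Set ν} {k : ℕ} {F G : CNF ν} (h1 : Reach V k F G)
    (h : cnfVars F ⊆ V) : cnfVars G ⊆ V := by
  induction h1 with
  | refl k F => exact h
  | step _ hv _ ih => exact ih hv

theorem cnfVars_union (F G : CNF ν) : cnfVars (F ∪ G) = cnfVars F ∪ cnfVars G := by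
  ext v
  simp only [cnfVars, Finset.mem_union, Set.mem_ofPred_eq, Set.mem_union]
  constructor
  · rintro ⟨C, h | h, b⟩
    · exact .inl ⟨C, h, b⟩
    · exact .inr ⟨C, h, b⟩
  · rintro (⟨C, h, b⟩ | ⟨C, h, b⟩)
    · exact ⟨C, .inl h, b⟩
    · exact ⟨C, .inr h, b⟩

theorem cnfVars_mono {F G : CNF ν} (h : F ⊆ G) : cnfVars F ⊆ cnfVars G := by
  rintro v ⟨C, hC, b⟩
  exact ⟨C, h hC, b⟩

theorem Reach.addDel {V : Set ν} (G H : CNF ν)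
    (hP : ∀ C ∈ H, ∀ H' ⊆ H, IsAT (G ∪ H') C ∨ IsRAT (G ∪ H') C)
    (hV : cnfVars (G ∪ H) ⊆ V) :
    Reach V H.card G (G ∪ H) ∧ Reach V H.card (G ∪ H) G := by
  induction H using Finset.induction_on with
  | empty => simpa using Reach.refl 0 G
  | insert C H hC ih =>
    have hsub : G ∪ H ⊆ G ∪ insert C H :=
      Finset.union_subset_union_right (Finset.subset_insert _ _)
    have hVH := (cnfVars_mono hsub).trans hV
    obtain ⟨h1, h2⟩ := ih (fun D hD H' hH' => hP D (Finset.mem_insert_of_mem hD) H'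
      (hH'.trans (Finset.subset_insert _ _))) hVH
    have hstep := hP C (Finset.mem_insert_self _ _) H (Finset.subset_insert _ _)
    rw [Finset.card_insert_of_notMem hC]
    constructor
    · refine h1.trans (.step (.inl ⟨C, hstep, ?_⟩) hV (.refl 0 _))
      exact Finset.union_insert C G H
    · by_cases hm : C ∈ G ∪ H
      · rw [Finset.union_insert, Finset.insert_eq_of_mem hm]
        exact h2.mono (Nat.le_succ _)
      · have he : (G ∪ insert C H).erase C = G ∪ H := by
          rw [Finset.union_insert, Finset.erase_insert hm]
        refine .step (.inr ⟨C, ?_, ?_, he.symm⟩) hVH h2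
        · simp
        · rw [he]; exact hstep

theorem Reach.addDelAT {V : Set ν} {n : ℕ} (G H : CNF ν) (hP : ∀ C ∈ H, IsAT G C)
    (hV : cnfVars (G ∪ H) ⊆ V) (hn : H.card ≤ n) :
    Reach V n G (G ∪ H) ∧ Reach V n (G ∪ H) G := by
  have := Reach.addDel G H (fun C hC H' _ => .inl ((hP C hC).mono Finset.subset_union_left)) hV
  exact ⟨this.1.mono hn, this.2.mono hn⟩

theorem cnfVars_X3 (a b c : Lit ν) : cnfVars (X3 a b c) = {a.1, b.1, c.1} := by
  ext v
  simp only [cnfVars, mem_X3, Set.mem_ofPred_eq, Set.mem_insert_iff, Set.mem_singleton_iff]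
  constructor
  · rintro ⟨C, ⟨i, j, rfl⟩, k, h⟩
    simp only [Finset.mem_insert, Finset.mem_singleton, lxor, Prod.mk.injEq] at h
    tauto
  · intro h
    refine ⟨_, ⟨true, true, rfl⟩, ?_⟩
    simp only [Finset.mem_insert, Finset.mem_singleton, lxor, Prod.mk.injEq]
    rcases h with rfl | rfl | rfl
    · exact ⟨_, .inl ⟨rfl, rfl⟩⟩
    · exact ⟨_, .inr (.inl ⟨rfl, rfl⟩)⟩
    · exact ⟨_, .inr (.inr ⟨rfl, rfl⟩)⟩

theorem cnfVars_X4 (a b c d : Lit ν) : cnfVars (X4 a b c d) ⊆ {a.1, b.1, c.1, d.1} := by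
  intro v
  simp only [cnfVars, mem_X4, Set.mem_ofPred_eq, Set.mem_insert_iff, Set.mem_singleton_iff]
  rintro ⟨C, ⟨i, j, k, rfl⟩, m, h⟩
  simp only [Finset.mem_insert, Finset.mem_singleton, lxor, Prod.mk.injEq] at h
  tauto

theorem cnfVars_Y4 (a b c d : Lit ν) : cnfVars (Y4 a b c d) ⊆ {a.1, b.1, c.1, d.1} := by
  intro v
  simp only [cnfVars, mem_Y4, Set.mem_ofPred_eq, Set.mem_insert_iff, Set.mem_singleton_iff]
  rintro ⟨C, ⟨i, j, k, rfl⟩, m, h⟩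
  simp only [Finset.mem_insert, Finset.mem_singleton, lxor, Prod.mk.injEq] at h
  tauto

/-- Eliminating / introducing the Tseitin variable `t`. -/
theorem Reach.half {V : Set ν} (R : CNF ν) (a b c o t : Lit ν)
    (hR : t.1 ∉ cnfVars R) (ha : a.1 ≠ t.1) (hb : b.1 ≠ t.1) (hc : c.1 ≠ t.1) (ho : o.1 ≠ t.1)
    (hV : cnfVars (R ∪ X3 a b t ∪ X3 t c o) ⊆ V) :
    Reach V 32 (R ∪ X3 a b t ∪ X3 t c o) (R ∪ X4 a b c o) ∧
    Reach V 32 (R ∪ X4 a b c o) (R ∪ X3 a b t ∪ X3 t c o) := by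
  have hV0 := hV
  simp only [cnfVars_union, cnfVars_X3, Set.union_subset_iff, Set.insert_subset_iff,
    Set.singleton_subset_iff] at hV
  obtain ⟨⟨hVR, hVa, hVb, hVt⟩, -, hVc, hVo⟩ := hV
  have hX4 : cnfVars (X4 a b c o) ⊆ V := (cnfVars_X4 a b c o).trans (by
    simp only [Set.insert_subset_iff, Set.singleton_subset_iff, hVa, hVb, hVc, hVo, hVt, and_self])
  have hY4 : cnfVars (Y4 t c o a) ⊆ V := (cnfVars_Y4 t c o a).trans (by
    simp only [Set.insert_subset_iff, Set.singleton_subset_iff, hVa, hVb, hVc, hVo, hVt, and_self])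
  have hX1 : cnfVars (X3 a b t) ⊆ V := by
    rw [cnfVars_X3]; simp only [Set.insert_subset_iff, Set.singleton_subset_iff, hVa, hVb, hVc, hVo, hVt, and_self]
  have hX2 : cnfVars (X3 t c o) ⊆ V := by
    rw [cnfVars_X3]; simp only [Set.insert_subset_iff, Set.singleton_subset_iff, hVa, hVb, hVc, hVo, hVt, and_self]
  have s1 := Reach.addDelAT (V := V) (n := 8) (R ∪ X3 a b t ∪ X3 t c o) (X4 a b c o)
    (fun C hC => at_X4 (t := t) (Finset.subset_union_right.trans Finset.subset_union_left)
      Finset.subset_union_right hC)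
    (by rw [cnfVars_union]; exact Set.union_subset hV0 hX4) (X4_card _ _ _ _)
  have s2 := Reach.addDelAT (V := V) (n := 8) (R ∪ X3 a b t ∪ X3 t c o ∪ X4 a b c o) (Y4 t c o a)
    (fun C hC => at_Y4 (b := b)
      (by intro x hx; simp only [Finset.mem_union, hx, true_or, or_true])
      Finset.subset_union_right hC)
    (by rw [cnfVars_union, cnfVars_union]
        exact Set.union_subset (Set.union_subset hV0 hX4) hY4) (Y4_card _ _ _ _)
  have s3 := Reach.addDelAT (V := V) (n := 4) (R ∪ X3 a b t ∪ X4 a b c o ∪ Y4 t c o a) (X3 t c o)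
    (fun C hC => at_X3_of_Y4 (d := a) Finset.subset_union_right hC)
    (by simp only [cnfVars_union, Set.union_subset_iff, hVR, hX1, hX2, hX4, hY4, and_self]) (X3_card _ _ _)
  have s4 := Reach.addDelAT (V := V) (n := 8) (R ∪ X3 a b t ∪ X4 a b c o) (Y4 t c o a)
    (fun C hC => at_Y4 (b := b)
      (by intro x hx; simp only [Finset.mem_union, hx, true_or, or_true])
      Finset.subset_union_right hC)
    (by simp only [cnfVars_union, Set.union_subset_iff, hVR, hX1, hX2, hX4, hY4, and_self]) (Y4_card _ _ _ _)
  have s5 := Reach.addDel (V := V) (R ∪ X4 a b c o) (X3 a b t)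
    (fun C hC H' hH' => .inr (rat_X3 ha hb (by
      intro D hD k hk
      simp only [Finset.mem_union] at hD
      rcases hD with (hD | hD) | hD
      · exact absurd ⟨D, hD, k, hk⟩ hR
      · have : t.1 ∈ cnfVars (X4 a b c o) := ⟨D, hD, k, hk⟩
        have := cnfVars_X4 a b c o this
        simp only [Set.mem_insert_iff, Set.mem_singleton_iff] at this
        rcases this with h | h | h | h
        · exact absurd h.symm ha
        · exact absurd h.symm hb
        · exact absurd h.symm hc
        · exact absurd h.symm ho
      · exact hH' hD) hC))
    (by simp only [cnfVars_union, Set.union_subset_iff, hVR, hX1, hX2, hX4, hY4, and_self])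
  have e1 : R ∪ X3 a b t ∪ X4 a b c o ∪ Y4 t c o a ∪ X3 t c o =
      R ∪ X3 a b t ∪ X3 t c o ∪ X4 a b c o ∪ Y4 t c o a := by
    ac_rfl
  have e2 : R ∪ X4 a b c o ∪ X3 a b t = R ∪ X3 a b t ∪ X4 a b c o := by
    ac_rfl
  rw [e1] at s3
  rw [e2] at s5
  have hcard := X3_card a b t
  constructor
  · exact ((((s1.1.trans s2.1).trans s3.2).trans s4.2).trans s5.2).mono (by omega)
  · exact ((((s5.1.trans s4.1).trans s3.1).trans s2.2).trans s1.2).mono (by omega)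

theorem Reach.rot {V : Set ν} (R : CNF ν) (a b c o t : Lit ν)
    (hR : t.1 ∉ cnfVars R) (ha : a.1 ≠ t.1) (hb : b.1 ≠ t.1) (hc : c.1 ≠ t.1) (ho : o.1 ≠ t.1)
    (hV : cnfVars (R ∪ X3 a b t ∪ X3 t c o) ⊆ V) :
    Reach V 64 (R ∪ X3 a b t ∪ X3 t c o) (R ∪ X3 b c t ∪ X3 a t o) := by
  have h1 := (Reach.half R a b c o t hR ha hb hc ho hV).1
  have h2 := (Reach.half (V := V) R b c a o t hR hb hc ha ho (by
    revert hV
    simp only [cnfVars_union, cnfVars_X3, Set.union_subset_iff, Set.insert_subset_iff,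
      Set.singleton_subset_iff]
    rintro ⟨⟨h1, h2, h3, h4⟩, h5, h6, h7⟩
    simp only [h1, h2, h3, h4, h6, h7, and_self])).2
  rw [← X4_rot, X3_swap12 t a o] at h2
  exact h1.trans h2

/-! ### Trees -/

inductive PTree (ν : Type) : Type
  | leaf (l : Lit ν) : PTree ν
  | node (o : Lit ν) (L R : PTree ν) : PTree ν

namespace PTree

def out : PTree ν → Lit ν
  | leaf l => l
  | node o _ _ => o

def cnf : PTree ν → CNF ν
  | leaf _ => ∅
  | node o L R => X3 L.out R.out o ∪ L.cnf ∪ R.cnf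

def labels : PTree ν → List ν
  | leaf l => [l.1]
  | node o L R => o.1 :: (L.labels ++ R.labels)

def innerAll : PTree ν → List ν
  | leaf _ => []
  | node o L R => o.1 :: (L.innerAll ++ R.innerAll)

def inner : PTree ν → List ν
  | leaf _ => []
  | node _ L R => L.innerAll ++ R.innerAll

theorem out_mem_labels (T : PTree ν) : T.out.1 ∈ T.labels := by
  cases T <;> simp [out, labels]

theorem inner_subset (T : PTree ν) : T.inner ⊆ T.innerAll := by
  cases T <;> simp [inner, innerAll]

theorem innerAll_subset (T : PTree ν) : T.innerAll ⊆ T.labels := by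
  induction T with
  | leaf l => simp [innerAll]
  | node o L R h1 h2 =>
    intro x
    simp only [innerAll, labels, List.mem_cons, List.mem_append]
    rintro (h | h | h)
    · exact .inl h
    · exact .inr (.inl (h1 h))
    · exact .inr (.inr (h2 h))

theorem cnfVars_cnf (T : PTree ν) : cnfVars T.cnf ⊆ {v | v ∈ T.labels} := by
  induction T with
  | leaf l => simp [cnf, cnfVars]
  | node o L R h1 h2 =>
    rw [cnf, cnfVars_union, cnfVars_union, cnfVars_X3]
    have hL := out_mem_labels L
    have hR := out_mem_labels R
    intro v
    simp only [Set.mem_union, Set.mem_insert_iff, Set.mem_singleton_iff, labels, Set.mem_ofPred_eq,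
      List.mem_cons, List.mem_append]
    rintro (((rfl | rfl | rfl) | h) | h)
    · tauto
    · tauto
    · tauto
    · exact .inr (.inl (h1 h))
    · exact .inr (.inr (h2 h))

theorem inner_ne_out {T : PTree ν} (h : T.labels.Nodup) : T.out.1 ∉ T.inner := by
  cases T with
  | leaf l => simp [inner]
  | node o L R =>
    simp only [labels, List.nodup_cons, List.mem_append, not_or] at h
    simp only [out, inner, List.mem_append, not_or]
    exact ⟨fun h' => h.1.1 (innerAll_subset L h'), fun h' => h.1.2 (innerAll_subset R h')⟩

/-- Reachability of trees by at most `k` rotations, modulo swapping children. -/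
inductive Rot : ℕ → PTree ν → PTree ν → Prop
  | refl (k : ℕ) (T : PTree ν) : Rot k T T
  | trans {k m : ℕ} {T U W : PTree ν} : Rot k T U → Rot m U W → Rot (k + m) T W
  | rot (o t : Lit ν) (A B C : PTree ν) :
      Rot 1 (node o (node t A B) C) (node o A (node t B C))
  | comm (o : Lit ν) (A B : PTree ν) : Rot 0 (node o A B) (node o B A)
  | congL {k : ℕ} (o : Lit ν) {A A' : PTree ν} (B : PTree ν) : Rot k A A' →
      Rot k (node o A B) (node o A' B)

theorem Rot.mono {k m : ℕ} {T U : PTree ν} (h : Rot k T U) (hkm : k ≤ m) : Rot m T U := by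
  obtain ⟨d, rfl⟩ := Nat.exists_eq_add_of_le hkm
  exact h.trans (.refl d U)

theorem Rot.congR {k : ℕ} (o : Lit ν) {A A' : PTree ν} (B : PTree ν) (h : Rot k A A') :
    Rot k (node o B A) (node o B A') :=
  (((Rot.comm o B A).trans (Rot.congL o B h)).trans (Rot.comm o A' B)).mono (by omega)

theorem Rot.rot' (o t : Lit ν) (A B C : PTree ν) :
    Rot 1 (node o A (node t B C)) (node o (node t A B) C) := by
  have h1 := Rot.comm o A (node t B C)
  have h2 := Rot.congL o A (Rot.comm t B C)
  have h3 := Rot.rot o t C B A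
  have h4 := Rot.comm o C (node t B A)
  have h5 := Rot.congL o C (Rot.comm t B A)
  exact ((((h1.trans h2).trans h3).trans h4).trans h5).mono (by omega)

theorem Rot.out_eq {k : ℕ} {T U : PTree ν} (h : Rot k T U) : U.out = T.out := by
  induction h with
  | refl => rfl
  | trans _ _ h1 h2 => rw [h2, h1]
  | rot => rfl
  | comm => rfl
  | congL => rfl

theorem Rot.labels_perm {k : ℕ} {T U : PTree ν} (h : Rot k T U) : U.labels.Perm T.labels := by
  classical
  induction h with
  | refl => exact .refl _
  | trans _ _ h1 h2 => exact h2.trans h1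
  | rot o t A B C =>
    rw [List.perm_iff_count]
    intro a
    simp only [labels, List.count_cons, List.count_append]
    omega
  | comm o A B =>
    simp only [labels]
    exact List.Perm.cons _ List.perm_append_comm
  | congL o B _ h =>
    simp only [labels]
    exact List.Perm.cons _ (List.Perm.append_right _ h)

theorem Rot.innerAll_perm {k : ℕ} {T U : PTree ν} (h : Rot k T U) :
    U.innerAll.Perm T.innerAll := by
  classical
  induction h with
  | refl => exact .refl _
  | trans _ _ h1 h2 => exact h2.trans h1
  | rot o t A B C =>
    rw [List.perm_iff_count]
    intro a
    simp only [innerAll, List.count_cons, List.count_append]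
    omega
  | comm o A B =>
    simp only [innerAll]
    exact List.Perm.cons _ List.perm_append_comm
  | congL o B _ h =>
    simp only [innerAll]
    exact List.Perm.cons _ (List.Perm.append_right _ h)

theorem Rot.inner_perm {k : ℕ} {T U : PTree ν} (h : Rot k T U) :
    U.inner.Perm T.inner := by
  classical
  induction h with
  | refl => exact .refl _
  | trans _ _ h1 h2 => exact h2.trans h1
  | rot o t A B C =>
    rw [List.perm_iff_count]
    intro a
    simp only [inner, innerAll, List.count_cons, List.count_append]
    omega
  | comm o A B =>
    simp only [inner]
    exact List.perm_append_comm
  | congL o B h _ =>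
    simp only [inner]
    exact List.Perm.append_right _ h.innerAll_perm

theorem Rot.reach {V : Set ν} {k : ℕ} {T U : PTree ν} (h : Rot k T U) :
    ∀ (R : CNF ν), T.labels.Nodup → (∀ v ∈ T.inner, v ∉ cnfVars R) →
      cnfVars (R ∪ T.cnf) ⊆ V → Reach V (64 * k) (R ∪ T.cnf) (R ∪ U.cnf) := by
  induction h with
  | refl => intros; exact .refl _ _
  | @trans k m T U W h1 h2 ih1 ih2 =>
    intro R hd hi hV
    have s1 := ih1 R hd hi hV
    have s2 := ih2 R (h1.labels_perm.nodup_iff.2 hd)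
      (fun v hv => hi v (h1.inner_perm.mem_iff.1 hv)) (s1.vars hV)
    rw [Nat.mul_add]
    exact s1.trans s2
  | rot o t A B C =>
    intro R hd hi hV
    have hA := out_mem_labels A
    have hB := out_mem_labels B
    have hC := out_mem_labels C
    simp only [labels, List.cons_append, List.nodup_cons, List.mem_cons, List.mem_append,
      not_or] at hd
    obtain ⟨⟨hot, ⟨-, -⟩, -⟩, ⟨⟨htA, htB⟩, htC⟩, -⟩ := hd
    have key := Reach.rot (V := V) (R ∪ A.cnf ∪ B.cnf ∪ C.cnf) A.out B.out C.out o t (by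
        rw [cnfVars_union, cnfVars_union, cnfVars_union]
        rintro (((h | h) | h) | h)
        · exact hi t.1 (by simp [inner, innerAll]) h
        · exact htA (cnfVars_cnf A h)
        · exact htB (cnfVars_cnf B h)
        · exact htC (cnfVars_cnf C h))
      (fun h => htA (h ▸ hA)) (fun h => htB (h ▸ hB)) (fun h => htC (h ▸ hC)) hot (by
        convert hV using 2
        simp only [cnf, out]; ac_rfl)
    convert key using 1
    · simp only [cnf, out]; ac_rfl
    · simp only [cnf, out]; ac_rfl
  | comm o A B =>
    intro R hd hi hV
    have : (node o A B).cnf = (node o B A).cnf := by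
      simp only [cnf]
      rw [X3_swap12, Finset.union_right_comm]
    rw [this]
    exact .refl _ _
  | @congL k o A A' B h ih =>
    intro R hd hi hV
    have hd' := hd
    simp only [labels, List.nodup_cons, List.mem_append, not_or, List.nodup_append] at hd'
    obtain ⟨⟨hoA, hoB⟩, hA, hB, hAB⟩ := hd'
    have key := ih (R ∪ X3 A.out B.out o ∪ B.cnf) hA (by
        intro v hv
        have hv1 := inner_subset A hv
        have hv2 := innerAll_subset A hv1
        rw [cnfVars_union, cnfVars_union, cnfVars_X3]
        rintro ((h | (h | h | h)) | h)
        · exact hi v (List.mem_append_left _ hv1) h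
        · exact inner_ne_out hA (h ▸ hv)
        · exact hAB v hv2 _ (out_mem_labels B) h
        · exact hoA (h ▸ hv2)
        · exact hAB v hv2 _ (cnfVars_cnf B h) rfl)
      (by
        convert hV using 2
        simp only [cnf]; ac_rfl)
    convert key using 1
    · simp only [cnf]; ac_rfl
    · simp only [cnf, h.out_eq]; ac_rfl

/-! ### Sorting combs -/

inductive IsComb : PTree ν → List (Lit ν) → Prop
  | leaf (a : Lit ν) : IsComb (leaf a) [a]
  | node (o a : Lit ν) {R : PTree ν} {l : List (Lit ν)} : IsComb R l →
      IsComb (node o (leaf a) R) (a :: l)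

def Desc (l : List (Lit ℕ)) : Prop := l.Pairwise (fun a b => b.1 ≤ a.1)

theorem merge_step {o : Lit ℕ} {A B : PTree ℕ} {a : Lit ℕ} {la lb : List (Lit ℕ)}
    (hA : IsComb A (a :: la)) (hB : IsComb B lb) (sa : Desc (a :: la)) (sb : Desc lb)
    (hle : ∀ x ∈ lb, x.1 ≤ a.1)
    (ih : ∀ (A' : PTree ℕ) (t : Lit ℕ), IsComb A' la → ∃ T l, IsComb T l ∧ l.Perm (la ++ lb) ∧
      Desc l ∧ Rot (la.length + lb.length) (node t A' B) T) :
    ∃ T l, IsComb T l ∧ l.Perm (a :: la ++ lb) ∧ Desc l ∧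
      Rot ((a :: la).length + lb.length) (node o A B) T := by
  obtain ⟨sa1, sa2⟩ := List.pairwise_cons.1 sa
  cases hA with
  | leaf =>
    exact ⟨_, _, .node o a hB, by simp, List.pairwise_cons.2 ⟨hle, sb⟩, .refl _ _⟩
  | @node t _ A' _ hA' =>
    obtain ⟨T, l, hT, hl, hs, hr⟩ := ih A' t hA'
    refine ⟨node o (leaf a) T, a :: l, .node o a hT, hl.cons a, List.pairwise_cons.2 ⟨?_, hs⟩, ?_⟩
    · intro x hx
      rcases List.mem_append.1 (hl.mem_iff.1 hx) with h | h
      · exact sa1 x h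
      · exact hle x h
    · exact ((Rot.rot o t (leaf a) A' B).trans (Rot.congR o _ hr)).mono (by
        simp only [List.length_cons]; omega)

theorem IsComb.ne_nil {A : PTree ν} {l : List (Lit ν)} (h : IsComb A l) : l ≠ [] := by
  cases h <;> simp

theorem Desc.head_le {a b : Lit ℕ} {l : List (Lit ℕ)} (h : Desc (b :: l)) (hab : b.1 ≤ a.1) :
    ∀ x ∈ b :: l, x.1 ≤ a.1 := by
  intro x hx
  rcases List.mem_cons.1 hx with rfl | hx
  · exact hab
  · exact ((List.pairwise_cons.1 h).1 x hx).trans hab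

theorem merge (N : ℕ) : ∀ (o : Lit ℕ) (A B : PTree ℕ) (la lb : List (Lit ℕ)),
    la.length + lb.length ≤ N → IsComb A la → IsComb B lb → Desc la → Desc lb →
    ∃ T l, IsComb T l ∧ l.Perm (la ++ lb) ∧ Desc l ∧
      Rot (la.length + lb.length) (node o A B) T := by
  induction N with
  | zero =>
    intro o A B la lb hN hA
    have := List.length_pos_of_ne_nil hA.ne_nil
    omega
  | succ N ih =>
    intro o A B la lb hN hA hB sa sb
    obtain ⟨a, la, rfl⟩ := List.exists_cons_of_ne_nil hA.ne_nil
    obtain ⟨b, lb, rfl⟩ := List.exists_cons_of_ne_nil hB.ne_nil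
    rcases le_total b.1 a.1 with h | h
    · refine merge_step hA hB sa sb (sb.head_le h) ?_
      intro A' t hA'
      exact ih t A' B la (b :: lb) (by simp only [List.length_cons] at hN ⊢; omega) hA' hB
        (List.pairwise_cons.1 sa).2 sb
    · obtain ⟨T, l, h1, h2, h3, h4⟩ := merge_step (o := o) hB hA sb sa (sa.head_le h) (by
        intro B' t hB'
        exact ih t B' A lb (a :: la) (by simp only [List.length_cons] at hN ⊢; omega) hB' hA
          (List.pairwise_cons.1 sb).2 sa)
      exact ⟨T, l, h1, h2.trans List.perm_append_comm, h3,
        ((Rot.comm o A B).trans h4).mono (by omega)⟩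

theorem split (l1 : List (Lit ν)) : ∀ (T : PTree ν) (l2 : List (Lit ν)), l1 ≠ [] → l2 ≠ [] →
    IsComb T (l1 ++ l2) → ∃ A B, IsComb A l1 ∧ IsComb B l2 ∧
      Rot l1.length T (node T.out A B) := by
  induction l1 with
  | nil => intro T l2 h; exact absurd rfl h
  | cons a l1 ih =>
    intro T l2 _ h2 hT
    generalize hl : a :: l1 ++ l2 = l at hT
    cases hT with
    | leaf b =>
      simp only [List.cons_append, List.cons.injEq, List.append_eq_nil_iff] at hl
      exact absurd hl.2.2 h2
    | @node o b R l hR =>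
      simp only [List.cons_append, List.cons.injEq] at hl
      obtain ⟨rfl, rfl⟩ := hl
      by_cases h1 : l1 = []
      · subst h1
        exact ⟨leaf a, R, .leaf a, hR, .refl _ _⟩
      · obtain ⟨A, B, hA, hB, hr⟩ := ih R l2 h1 h2 hR
        exact ⟨node R.out (leaf a) A, B, .node _ _ hA, hB,
          (Rot.congR o (leaf a) hr).trans (Rot.rot' o R.out (leaf a) A B)⟩

theorem sort (d : ℕ) : ∀ (l : List (Lit ℕ)) (T : PTree ℕ), l.length ≤ 2 ^ d → IsComb T l →
    ∃ T' l', IsComb T' l' ∧ l'.Perm l ∧ Desc l' ∧ Rot (2 * d * l.length) T T' := by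
  induction d with
  | zero =>
    intro l T hl hT
    refine ⟨T, l, hT, .refl _, ?_, .refl _ _⟩
    match l, hl with
    | [], _ => exact List.Pairwise.nil
    | [a], _ => exact List.pairwise_singleton _ _
  | succ d ih =>
    intro l T hl hT
    by_cases h1 : l.length ≤ 1
    · refine ⟨T, l, hT, .refl _, ?_, .refl _ _⟩
      match l, h1 with
      | [], _ => exact List.Pairwise.nil
      | [a], _ => exact List.pairwise_singleton _ _
    · have e := List.take_append_drop (l.length / 2) l
      have len1 : (l.take (l.length / 2)).length = l.length / 2 := by
        rw [List.length_take]; omega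
      have len2 : (l.drop (l.length / 2)).length = l.length - l.length / 2 := by
        rw [List.length_drop]
      generalize l.take (l.length / 2) = l1 at *
      generalize l.drop (l.length / 2) = l2 at *
      rw [pow_succ] at hl
      obtain ⟨A, B, hA, hB, hr⟩ := split l1 T l2
        (List.ne_nil_of_length_pos (by omega)) (List.ne_nil_of_length_pos (by omega)) (e ▸ hT)
      obtain ⟨A', la, hA', pa, sa, ra⟩ := ih l1 A (by omega) hA
      obtain ⟨B', lb, hB', pb, sb, rb⟩ := ih l2 B (by omega) hB
      obtain ⟨T', l', hT', pl, sl, rl⟩ := merge _ T.out A' B' la lb le_rfl hA' hB' sa sb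
      refine ⟨T', l', hT', (pl.trans (pa.append pb)).trans (by rw [e]), sl, ?_⟩
      refine (((hr.trans (Rot.congL _ B ra)).trans (Rot.congR _ A' rb)).trans rl).mono ?_
      rw [pa.length_eq, pb.length_eq]
      have hlen : l.length = l1.length + l2.length := by rw [← e, List.length_append]
      rw [hlen]
      nlinarith

end PTree

/-! ### The final contradiction -/

def E2 (a b : Lit ν) : CNF ν :=
  (Finset.univ : Finset Bool).image (fun i => {lxor a i, lxor b (!i)})

def E3 (a b c : Lit ν) : CNF ν :=
  (Finset.univ : Finset (Bool × Bool)).image (fun p => {lxor a p.1, lxor b (!p.1), lxor c p.2})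

theorem mem_E2 {a b : Lit ν} {C : Clause ν} : C ∈ E2 a b ↔ ∃ i, C = {lxor a i, lxor b (!i)} := by
  simp only [E2, Finset.mem_image, Finset.mem_univ, true_and]
  exact ⟨fun ⟨i, h⟩ => ⟨i, h.symm⟩, fun ⟨i, h⟩ => ⟨i, h.symm⟩⟩

theorem mem_E3 {a b c : Lit ν} {C : Clause ν} :
    C ∈ E3 a b c ↔ ∃ i j, C = {lxor a i, lxor b (!i), lxor c j} := by
  simp only [E3, Finset.mem_image, Finset.mem_univ, true_and, Prod.exists]
  exact ⟨fun ⟨i, j, h⟩ => ⟨i, j, h.symm⟩, fun ⟨i, j, h⟩ => ⟨i, j, h.symm⟩⟩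

theorem cnfVars_E2 {V : Set ν} {a b : Lit ν} (ha : a.1 ∈ V) (hb : b.1 ∈ V) :
    cnfVars (E2 a b) ⊆ V := by
  rintro v ⟨C, hC, k, hk⟩
  obtain ⟨i, rfl⟩ := mem_E2.1 hC
  simp only [Finset.mem_insert, Finset.mem_singleton, lxor, Prod.mk.injEq] at hk
  rcases hk with ⟨rfl, -⟩ | ⟨rfl, -⟩ <;> assumption

theorem cnfVars_E3 {V : Set ν} {a b c : Lit ν} (ha : a.1 ∈ V) (hb : b.1 ∈ V) (hc : c.1 ∈ V) :
    cnfVars (E3 a b c) ⊆ V := by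
  rintro v ⟨C, hC, k, hk⟩
  obtain ⟨i, j, rfl⟩ := mem_E3.1 hC
  simp only [Finset.mem_insert, Finset.mem_singleton, lxor, Prod.mk.injEq] at hk
  rcases hk with ⟨rfl, -⟩ | ⟨rfl, -⟩ | ⟨rfl, -⟩ <;> assumption

theorem Holds.e2 {F : CNF ν} {a b : Lit ν} {α : Bool} (h : E2 a b ⊆ F)
    (ha : Holds F a α) : Holds F b α := by
  refine Prov.clause (h (mem_E2.2 ⟨α, rfl⟩)) ?_
  intro l hl
  simp only [Finset.mem_insert, Finset.mem_singleton] at hl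
  rcases hl with rfl | rfl
  · right; rw [negLit_lxor]; exact ha
  · left; rfl

theorem at_E2_refl {F : CNF ν} {a : Lit ν} {C : Clause ν} (hC : C ∈ E2 a a) : IsAT F C := by
  obtain ⟨i, rfl⟩ := mem_E2.1 hC
  apply UPD.refutes
  have hs := @Finset.subset_union_right _ _ F (clauseNegCNF {lxor a i, lxor a (!i)})
  have h1 := Holds.of_mem (a := a) (i := i) hs (by simp)
  have h2 := Holds.of_mem (a := a) (i := !i) hs (by simp)
  exact h1.contra h2 (by simp)

theorem at_E3 {F : CNF ν} {a r s o p : Lit ν} (h1 : X3 a r o ⊆ F) (h2 : X3 a s p ⊆ F)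
    (h3 : E2 r s ⊆ F) {C : Clause ν} (hC : C ∈ E3 o p a) : IsAT F C := by
  obtain ⟨i, j, rfl⟩ := mem_E3.1 hC
  apply UPD.refutes
  have hs := @Finset.subset_union_right _ _ F (clauseNegCNF {lxor o i, lxor p (!i), lxor a j})
  have ho := Holds.of_mem (a := o) (i := i) hs (by simp)
  have hp := Holds.of_mem (a := p) (i := !i) hs (by simp)
  have ha := Holds.of_mem (a := a) (i := j) hs (by simp)
  rw [X3_swap23] at h1
  have hr := Holds.x3 (h1.trans Finset.subset_union_left) ha ho
  have hs' := Holds.e2 (h3.trans Finset.subset_union_left) hr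
  have hp' := Holds.x3 (h2.trans Finset.subset_union_left) ha hs'
  exact hp.contra hp' (by cases i <;> cases j <;> simp)

theorem at_E2_of_E3 {F : CNF ν} {a b c : Lit ν} (h1 : E3 a b c ⊆ F) {C : Clause ν}
    (hC : C ∈ E2 a b) : IsAT F C := by
  obtain ⟨i, rfl⟩ := mem_E2.1 hC
  apply UPD.refutes
  have hs := @Finset.subset_union_right _ _ F (clauseNegCNF {lxor a i, lxor b (!i)})
  have ha := Holds.of_mem (a := a) (i := i) hs (by simp)
  have hb := Holds.of_mem (a := b) (i := !i) hs (by simp)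
  have hd : ∀ k, Holds (F ∪ clauseNegCNF {lxor a i, lxor b (!i)}) c (!k) := by
    intro k
    refine Prov.clause (Finset.mem_union_left _ (h1 (mem_E3.2 ⟨i, k, rfl⟩))) ?_
    intro l hl
    simp only [Finset.mem_insert, Finset.mem_singleton] at hl
    rcases hl with rfl | rfl | rfl
    · right; rw [negLit_lxor]; exact ha
    · right; rw [negLit_lxor]; exact hb
    · left; simp
  exact (hd true).contra (hd false) (by simp)

namespace PTree

theorem equate {V : Set ν} {A : PTree ν} {l : List (Lit ν)} (hA : IsComb A l) :
    ∀ (B : PTree ν) (F : CNF ν), IsComb B l → A.cnf ⊆ F → B.cnf ⊆ F →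
      (∀ v ∈ A.labels, v ∈ V) → (∀ v ∈ B.labels, v ∈ V) → cnfVars F ⊆ V →
      ∃ F', F ⊆ F' ∧ E2 A.out B.out ⊆ F' ∧ Reach V (6 * l.length) F F' := by
  induction hA with
  | leaf a =>
    intro B F hB _ _ hVA _ hV
    cases hB with
    | leaf =>
      refine ⟨F ∪ E2 a a, Finset.subset_union_left, Finset.subset_union_right, ?_⟩
      have ha : a.1 ∈ V := hVA _ (by simp [labels])
      exact (Reach.addDelAT (n := 6) F (E2 a a) (fun C hC => at_E2_refl hC)
        (by rw [cnfVars_union]; exact Set.union_subset hV (cnfVars_E2 ha ha))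
        (Finset.card_image_le.trans (by simp))).1
    | node _ _ h => exact absurd rfl h.ne_nil
  | @node o a R l hR ih =>
    intro B F hB hAF hBF hVA hVB hV
    cases hB with
    | leaf => exact absurd rfl hR.ne_nil
    | @node p _ S _ hS =>
      simp only [cnf, out, Finset.union_subset_iff] at hAF hBF
      obtain ⟨⟨hA1, -⟩, hA2⟩ := hAF
      obtain ⟨⟨hB1, -⟩, hB2⟩ := hBF
      obtain ⟨F1, hF1, hE, hr⟩ := ih S F hS hA2 hB2
        (fun v hv => hVA v (by simp [labels, hv])) (fun v hv => hVB v (by simp [labels, hv])) hV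
      have ho : o.1 ∈ V := hVA _ (by simp [labels])
      have ha : a.1 ∈ V := hVA _ (by simp [labels])
      have hp : p.1 ∈ V := hVB _ (by simp [labels])
      have hV1 := hr.vars hV
      have hV2 : cnfVars (F1 ∪ E3 o p a) ⊆ V := by
        rw [cnfVars_union]; exact Set.union_subset hV1 (cnfVars_E3 ho hp ha)
      have s1 := (Reach.addDelAT (V := V) (n := 4) F1 (E3 o p a)
        (fun C hC => at_E3 (hA1.trans hF1) (hB1.trans hF1) hE hC) hV2
        (Finset.card_image_le.trans (by simp))).1
      have s2 := (Reach.addDelAT (V := V) (n := 2) (F1 ∪ E3 o p a) (E2 o p)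
        (fun C hC => at_E2_of_E3 Finset.subset_union_right hC)
        (by rw [cnfVars_union]; exact Set.union_subset hV2 (cnfVars_E2 ho hp))
        (Finset.card_image_le.trans (by simp))).1
      refine ⟨F1 ∪ E3 o p a ∪ E2 o p, ?_, Finset.subset_union_right, ?_⟩
      · exact (hF1.trans Finset.subset_union_left).trans Finset.subset_union_left
      · exact ((hr.trans s1).trans s2).mono (by simp only [List.length_cons]; omega)

theorem labels_subset (T : PTree ν) : ∀ v ∈ T.labels, v = T.out.1 ∨ v ∈ cnfVars T.cnf := by
  induction T with
  | leaf l => intro v hv; left; simpa [labels, out] using hv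
  | node o L R h1 h2 =>
    intro v hv
    simp only [cnf, cnfVars_union, cnfVars_X3, Set.mem_union, Set.mem_insert_iff,
      Set.mem_singleton_iff, out]
    simp only [labels, List.mem_cons, List.mem_append] at hv
    rcases hv with h | h | h
    · exact .inl h
    · rcases h1 v h with h | h
      · exact .inr (.inl (.inl (.inl h)))
      · exact .inr (.inl (.inr h))
    · rcases h2 v h with h | h
      · exact .inr (.inl (.inl (.inr (.inl h))))
      · exact .inr (.inr h)

theorem labels_node_subset {o : Lit ν} {L R : PTree ν} :
    ∀ v ∈ (node o L R).labels, v ∈ cnfVars (node o L R).cnf := by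
  intro v hv
  rcases labels_subset _ v hv with h | h
  · subst h
    simp only [cnf, cnfVars_union, cnfVars_X3, out]
    simp
  · exact h

end PTree

/-! ### The parity chain as a comb -/

theorem xorCNF_three (a b c : Lit ν) : xorCNF [a, b, c] = X3 a b c := by
  have key : ∀ f : Fin 3 → Bool, (Finset.univ.filter (fun i => f i = true)).card % 2 = 1 ↔
      f 2 = !(xor (f 0) (f 1)) := by decide
  have hl : ∀ (l : Lit ν) (i : Bool), (if i = true then negLit l else l) = lxor l i := by
    intro l i; cases i <;> simp [negLit, lxor]
  have himg : ∀ f : Fin 3 → Bool, (Finset.univ : Finset (Fin 3)).image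
      (fun i => if f i = true then negLit ([a, b, c].get i) else [a, b, c].get i) =
      {lxor a (f 0), lxor b (f 1), lxor c (f 2)} := by
    intro f
    ext x
    simp only [Finset.mem_image, Finset.mem_univ, true_and, Fin.exists_fin_succ, hl,
      Finset.mem_insert, Finset.mem_singleton]
    simp [eq_comm]
  ext C
  rw [mem_X3]
  unfold xorCNF parityCNF
  rw [Finset.mem_image]
  constructor
  · rintro ⟨f, hf, rfl⟩
    have hf' := (key f).1 (by simpa using hf)
    refine ⟨f 0, f 1, ?_⟩
    rw [← hf']
    exact himg f
  · rintro ⟨i, j, rfl⟩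
    refine ⟨(![i, j, !(xor i j)] : Fin 3 → Bool), ?_, ?_⟩
    · rw [Finset.mem_filter]
      refine ⟨Finset.mem_univ _, ?_⟩
      exact (key ![i, j, !(xor i j)]).2 rfl
    · exact himg ![i, j, !(xor i j)]

def chainT (x : ℕ → Lit ν) (t : ℕ → ν) : ℕ → PTree ν
  | 0 => .leaf (x 0)
  | j + 1 => .node (t j, true) (.leaf (x (j + 1))) (chainT x t j)

def chainL (x : ℕ → Lit ν) : ℕ → List (Lit ν)
  | 0 => [x 0]
  | j + 1 => x (j + 1) :: chainL x j

theorem chainT_comb (x : ℕ → Lit ν) (t : ℕ → ν) (j : ℕ) :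
    PTree.IsComb (chainT x t j) (chainL x j) := by
  induction j with
  | zero => exact .leaf _
  | succ j ih => exact .node _ _ ih

def fullT (x : ℕ → Lit ν) (t : ℕ → ν) (m : ℕ) : PTree ν :=
  .node (x (m + 2)) (.leaf (x (m + 1))) (chainT x t m)

theorem fullT_comb (x : ℕ → Lit ν) (t : ℕ → ν) (m : ℕ) :
    PTree.IsComb (fullT x t m) (chainL x (m + 1)) :=
  .node _ _ (chainT_comb x t m)

theorem chainL_length (x : ℕ → Lit ν) (j : ℕ) : (chainL x j).length = j + 1 := by
  induction j with
  | zero => rfl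
  | succ j ih => simp [chainL, ih]

theorem chainL_eq (x : ℕ → Lit ν) (j : ℕ) :
    chainL x j = ((List.range (j + 1)).map x).reverse := by
  induction j with
  | zero => rfl
  | succ j ih => rw [List.range_succ, List.map_append, List.reverse_append, ← ih]; rfl

theorem chainT_innerAll (x : ℕ → Lit ν) (t : ℕ → ν) (j : ℕ) :
    (chainT x t j).innerAll = ((List.range j).map t).reverse := by
  induction j with
  | zero => rfl
  | succ j ih => rw [List.range_succ, List.map_append, List.reverse_append, ← ih]; rfl

theorem PTree.IsComb.labels_perm {T : PTree ν} {l : List (Lit ν)} (h : IsComb T l) :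
    T.labels.Perm (l.map Prod.fst ++ T.innerAll) := by
  induction h with
  | leaf a => simp [labels, innerAll]
  | @node o a R l _ ih =>
    rw [List.perm_iff_count] at ih ⊢
    intro v
    have := ih v
    simp only [labels, innerAll, List.map_cons, List.count_cons, List.count_append,
      List.count_nil] at this ⊢
    omega

theorem chainT_cnf (xs : List (Lit ν)) (t : ℕ → ν) (m j : ℕ) (hlen : xs.length = m + 3)
    (hj : j ≤ m) :
    (chainT (fun i => xs.getD i (t 0, true)) t j).cnf =
      (Finset.range j).biUnion (fun j => xorCNF (parityCtr xs t j)) := by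
  induction j with
  | zero => rfl
  | succ j ih =>
    rw [Finset.range_add_one, Finset.biUnion_insert, ← ih (by omega)]
    have : X3 (xs.getD (j + 1) (t 0, true))
        (chainT (fun i => xs.getD i (t 0, true)) t j).out (t j, true) =
        xorCNF (parityCtr xs t j) := by
      cases j with
      | zero =>
        rw [parityCtr, if_pos rfl, xorCNF_three, X3_swap12]
        rfl
      | succ j =>
        rw [parityCtr, if_neg (by omega), if_pos (by omega), xorCNF_three, X3_swap12]
        rfl
    rw [← this]
    simp only [chainT, PTree.cnf, PTree.out, Finset.union_empty]

theorem fullT_cnf (xs : List (Lit ν)) (t : ℕ → ν) (m : ℕ) (hlen : xs.length = m + 1 + 3) :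
    ParityCNF xs t = (fullT (fun i => xs.getD i (t 0, true)) t (m + 1)).cnf := by
  rw [ParityCNF, show xs.length - 2 = (m + 1) + 1 by omega, Finset.range_add_one,
    Finset.biUnion_insert, ← chainT_cnf xs t (m + 1) (m + 1) hlen le_rfl]
  have : X3 (xs.getD (m + 1 + 1) (t 0, true))
      (chainT (fun i => xs.getD i (t 0, true)) t (m + 1)).out (xs.getD (m + 1 + 2) (t 0, true)) =
      xorCNF (parityCtr xs t (m + 1)) := by
    rw [parityCtr, if_neg (by omega), if_neg (by omega), xorCNF_three, X3_swap12]
    rw [show xs.length - 4 = m by omega, show xs.length - 2 = m + 1 + 1 by omega,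
      show xs.length - 1 = m + 1 + 2 by omega]
    rfl
  rw [← this]
  simp only [fullT, PTree.cnf, PTree.out, Finset.union_empty]

theorem chainL_getD (xs : List (Lit ν)) (d : Lit ν) (j : ℕ) (h : xs.length = j + 1) :
    chainL (fun i => xs.getD i d) j = xs.reverse := by
  rw [chainL_eq]
  congr 1
  apply List.ext_getElem
  · simp [h]
  · intro i h1 h2
    simp [h2]

theorem Reach.toList {V : Set ν} {k : ℕ} {F G : CNF ν} (h : Reach V k F G)
    (hF : cnfVars F ⊆ V) : ∃ Fs : List (CNF ν), Fs ≠ [] ∧ List.IsChain DRATStep Fs ∧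
      Fs.head? = some F ∧ Fs.getLast? = some G ∧ (∀ H ∈ Fs, cnfVars H ⊆ V) ∧
      Fs.length ≤ k + 1 := by
  induction h with
  | refl k F => exact ⟨[F], by simp, List.isChain_singleton _, rfl, rfl, by simpa using hF, by simp⟩
  | @step k F G H hs hv _ ih =>
    obtain ⟨Fs, h1, h2, h3, h4, h5, h6⟩ := ih hv
    obtain ⟨F1, Fs, rfl⟩ := List.exists_cons_of_ne_nil h1
    simp only [List.head?_cons, Option.some.injEq] at h3
    subst h3
    refine ⟨F :: F1 :: Fs, by simp, List.IsChain.cons_cons hs h2, rfl, ?_, ?_, ?_⟩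
    · rw [List.getLast?_cons_cons]; exact h4
    · intro K hK
      rcases List.mem_cons.1 hK with rfl | hK
      · exact hF
      · exact h5 K hK
    · simp only [List.length_cons] at h6 ⊢; omega

/-- Move the leaf at the top of a comb to the root. -/
theorem PTree.reroot {T : PTree ν} {a : Lit ν} {l : List (Lit ν)} (hT : IsComb T (a :: l))
    (hl : l ≠ []) : ∃ U, IsComb U (T.out :: l) ∧ U.out = a ∧ U.cnf = T.cnf ∧
      U.labels.Perm T.labels ∧ U.inner = T.inner := by
  cases hT with
  | leaf => exact absurd rfl hl
  | @node o _ R _ hR =>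
    refine ⟨.node a (.leaf o) R, .node _ _ hR, rfl, ?_, ?_, rfl⟩
    · simp only [cnf, out]
      rw [X3_swap12, X3_swap23, X3_swap12]
    · simp only [labels]
      exact List.Perm.swap _ _ _

theorem chainL_id_desc (j : ℕ) : PTree.Desc (chainL (fun i : ℕ => ((i, true) : Lit ℕ)) j) := by
  have hm : ∀ j, ∀ x ∈ chainL (fun i : ℕ => ((i, true) : Lit ℕ)) j, x.1 ≤ j := by
    intro j x hx
    rw [chainL_eq] at hx
    simp only [List.mem_reverse, List.mem_map, List.mem_range] at hx
    obtain ⟨i, hi, rfl⟩ := hx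
    simp only; omega
  induction j with
  | zero => exact List.pairwise_singleton _ _
  | succ j ih =>
    refine List.pairwise_cons.2 ⟨fun x hx => ?_, ih⟩
    have := hm j x hx
    simp only; omega

theorem xListA_getD (n i : ℕ) (h : i < n) (d : Lit ℕ) : (xListA n).getD i d = (i, true) := by
  rw [List.getD_eq_getElem _ _ (by simpa [xListA] using h)]
  unfold xListA
  rw [List.getElem_ofFn]

theorem xListA_chain (m : ℕ) (d : Lit ℕ) :
    chainL (fun i => (xListA (m + 3)).getD i d) (m + 1) =
      chainL (fun i : ℕ => ((i, true) : Lit ℕ)) (m + 1) := by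
  rw [chainL_eq, chainL_eq]
  congr 1
  apply List.map_congr_left
  intro i hi
  rw [List.mem_range] at hi
  exact xListA_getD _ _ (by omega) _

theorem xListB_perm (m : ℕ) (σ : Equiv.Perm (Fin (m + 3))) :
    (xListB (m + 3) σ).Perm
      ((m + 2, false) :: chainL (fun i : ℕ => ((i, true) : Lit ℕ)) (m + 1)) := by
  have h1 : (xListB (m + 3) σ).Perm (List.ofFn
      (fun i : Fin (m + 3) => (((i : ℕ), decide ((i : ℕ) ≠ m + 2)) : Lit ℕ))) :=
    Equiv.Perm.ofFn_comp_perm σ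
      (fun i : Fin (m + 3) => (((i : ℕ), decide ((i : ℕ) ≠ m + 2)) : Lit ℕ))
  refine h1.trans ?_
  rw [chainL_eq]
  have h2 : List.ofFn (fun i : Fin (m + 3) => (((i : ℕ), decide ((i : ℕ) ≠ m + 2)) : Lit ℕ)) =
      (List.range (m + 2)).map (fun i : ℕ => ((i, true) : Lit ℕ)) ++ [(m + 2, false)] := by
    apply List.ext_getElem
    · simp
    · intro i hi1 hi2
      rw [List.length_ofFn] at hi1
      rw [List.getElem_ofFn, List.getElem_append]
      split
      · next h =>
        simp only [List.length_map, List.length_range] at h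
        simp; omega
      · next h =>
        simp only [List.length_map, List.length_range] at h
        have : i = m + 2 := by omega
        subst this
        simp
  rw [h2]
  exact List.perm_append_comm.trans (List.Perm.cons _ (List.reverse_perm _).symm)

theorem main_reach (m : ℕ) (σ : Equiv.Perm (Fin (m + 4))) (d : ℕ) (hd : m + 3 ≤ 2 ^ d) :
    ∃ G, (∅ : Clause ℕ) ∈ G ∧
      Reach (cnfVars (rPar (m + 4) σ)) (256 * d * (m + 3) + 6 * (m + 3) + 1)
        (rPar (m + 4) σ) G := by
  set V := cnfVars (rPar (m + 4) σ) with hVdef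
  set tA : ℕ → ℕ := fun k => m + 4 + k with htA
  set tB : ℕ → ℕ := fun k => 2 * (m + 4) + k with htB
  set xA : ℕ → Lit ℕ := fun i => (xListA (m + 4)).getD i (tA 0, true) with hxA
  set xB : ℕ → Lit ℕ := fun i => (xListB (m + 4) σ).getD i (tB 0, true) with hxB
  set lA := chainL (fun i : ℕ => ((i, true) : Lit ℕ)) (m + 2) with hlA
  set TA := fullT xA tA (m + 1) with hTA
  set TB := fullT xB tB (m + 1) with hTB
  have hF : rPar (m + 4) σ = TA.cnf ∪ TB.cnf := by
    rw [rPar, fullT_cnf (xListA (m + 4)) tA m (by simp [xListA]),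
      fullT_cnf (xListB (m + 4) σ) tB m (by simp [xListB])]
  have hAout : TA.out = (m + 3, true) := by
    exact xListA_getD (m + 4) (m + 3) (by omega) _
  have hAcomb : PTree.IsComb TA lA := by
    have := fullT_comb xA tA (m + 1)
    rwa [hxA, xListA_chain (m + 1)] at this
  have hBcomb := fullT_comb xB tB (m + 1)
  rw [← hTB] at hBcomb
  have hBperm : (TB.out :: chainL xB (m + 2)).Perm ((m + 3, false) :: lA) := by
    have h1 : TB.out :: chainL xB (m + 2) = chainL xB (m + 3) := rfl
    rw [h1, chainL_getD (xListB (m + 4) σ) _ (m + 3) (by simp [xListB])]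
    exact (List.reverse_perm _).trans (xListB_perm (m + 1) σ)
  -- variables of the two trees
  have hlAlt : ∀ x ∈ lA, x.1 < m + 3 ∧ x.2 = true := by
    intro x hx
    rw [hlA, chainL_eq] at hx
    simp only [List.mem_reverse, List.mem_map, List.mem_range] at hx
    obtain ⟨i, hi, rfl⟩ := hx
    exact ⟨hi, rfl⟩
  have hAinner : TA.innerAll = (m + 3) :: ((List.range (m + 1)).map tA).reverse := by
    rw [← chainT_innerAll xA tA (m + 1)]
    have : TA.innerAll = TA.out.1 :: ([] ++ (chainT xA tA (m + 1)).innerAll) := rfl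
    rw [this, hAout]; rfl
  have hBinner : TB.inner = ((List.range (m + 1)).map tB).reverse := by
    rw [← chainT_innerAll xB tB (m + 1)]
    rfl
  have hAlt : ∀ v ∈ TA.labels, v < 2 * (m + 4) := by
    intro v hv
    have := hAcomb.labels_perm.mem_iff.1 hv
    rw [List.mem_append, hAinner] at this
    rcases this with h | h
    · obtain ⟨x, hx, rfl⟩ := List.mem_map.1 h
      have := hlAlt x hx
      omega
    · simp only [List.mem_cons, List.mem_reverse, List.mem_map, List.mem_range] at h
      rcases h with h | ⟨i, hi, rfl⟩
      · omega
      · simp only [htA]; omega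
  have hBnotA : ∀ v ∈ TB.inner, v ∉ cnfVars TA.cnf := by
    intro v hv h
    have h1 := hAlt v (PTree.cnfVars_cnf TA h)
    rw [hBinner] at hv
    simp only [List.mem_reverse, List.mem_map, List.mem_range] at hv
    obtain ⟨i, hi, rfl⟩ := hv
    simp only [htB] at h1; omega
  have hBlabels : TB.labels.Perm ((TB.out :: chainL xB (m + 2)).map Prod.fst ++ TB.inner) := by
    refine hBcomb.labels_perm.trans ?_
    have : TB.innerAll = TB.out.1 :: TB.inner := rfl
    rw [this, List.map_cons, List.cons_append]
    exact List.perm_middle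
  have hBnodup : TB.labels.Nodup := by
    rw [(hBlabels.trans ((hBperm.map _).append_right _)).nodup_iff, List.nodup_append]
    refine ⟨?_, ?_, ?_⟩
    · rw [List.map_cons, List.nodup_cons]
      constructor
      · intro h
        obtain ⟨x, hx, hx2⟩ := List.mem_map.1 h
        have := (hlAlt x hx).1
        simp only at hx2
        omega
      · rw [hlA, chainL_eq, List.map_reverse, List.nodup_reverse, List.map_map]
        exact List.nodup_range.map (fun a b h => h)
    · rw [hBinner, List.nodup_reverse]
      exact List.nodup_range.map (fun a b h => by simpa [htB] using h)
    · intro v hv w hw hvw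
      subst hvw
      rw [hBinner] at hw
      simp only [List.mem_reverse, List.mem_map, List.mem_range] at hw
      obtain ⟨i, hi, rfl⟩ := hw
      obtain ⟨x, hx, hx2⟩ := List.mem_map.1 hv
      simp only [htB] at hx2
      rcases List.mem_cons.1 hx with rfl | hx
      · simp only at hx2; omega
      · have := (hlAlt x hx).1
        omega
  have hV0 : cnfVars (TA.cnf ∪ TB.cnf) ⊆ V := by rw [hVdef, hF]
  have hVA : ∀ v ∈ TA.labels, v ∈ V := fun v hv => hV0 (by
    rw [cnfVars_union]; exact .inl (PTree.labels_node_subset v hv))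
  have hVB : ∀ v ∈ TB.labels, v ∈ V := fun v hv => hV0 (by
    rw [cnfVars_union]; exact .inr (PTree.labels_node_subset v hv))
  have hBlen : (chainL xB (m + 2)).length = m + 3 := chainL_length _ _
  -- first sorting phase
  obtain ⟨T1, l1, hT1, hl1, hs1, hr1⟩ := PTree.sort d _ TB (by rw [hBlen]; exact hd) hBcomb
  rw [hBlen] at hr1
  have R1 := hr1.reach (V := V) TA.cnf hBnodup hBnotA hV0
  have hperm1 : (T1.out :: l1).Perm ((m + 3, false) :: lA) := by
    rw [hr1.out_eq]
    exact (hl1.cons _).trans hBperm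
  -- re-rooting
  obtain ⟨T2, l2, hT2, hout2, hcnf2, hlab2, hinn2, hperm2⟩ : ∃ T2 l2, PTree.IsComb T2 l2 ∧
      T2.out = (m + 3, false) ∧ T2.cnf = T1.cnf ∧ T2.labels.Perm T1.labels ∧
      T2.inner = T1.inner ∧ l2.Perm lA := by
    by_cases ho : T1.out = (m + 3, false)
    · exact ⟨T1, l1, hT1, ho, rfl, .refl _, rfl, by
        rw [ho] at hperm1; exact hperm1.cons_inv⟩
    · have hmem : ((m + 3, false) : Lit ℕ) ∈ l1 := by
        have : ((m + 3, false) : Lit ℕ) ∈ T1.out :: l1 :=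
          hperm1.mem_iff.2 List.mem_cons_self
        rcases List.mem_cons.1 this with h | h
        · exact absurd h.symm ho
        · exact h
      obtain ⟨a, l, rfl⟩ := List.exists_cons_of_ne_nil hT1.ne_nil
      have ha : a = (m + 3, false) := by
        have h1 : a ∈ ((m + 3, false) : Lit ℕ) :: lA := hperm1.mem_iff.1 (by simp)
        rcases List.mem_cons.1 h1 with h | h
        · exact h
        · have h2 := (hlAlt a h).1
          rcases List.mem_cons.1 hmem with h3 | h3
          · exact h3.symm
          · have := (List.pairwise_cons.1 hs1).1 _ h3
            simp only at this
            omega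
      subst ha
      have hlen := hl1.length_eq
      rw [hBlen, List.length_cons] at hlen
      obtain ⟨U, h1, h2, h3, h4, h5⟩ := PTree.reroot hT1
        (List.ne_nil_of_length_pos (by omega))
      refine ⟨U, _, h1, h2, h3, h4, h5, ?_⟩
      exact ((List.Perm.swap _ _ _).trans hperm1).cons_inv
  have hlen2 : l2.length = m + 3 := by rw [hperm2.length_eq, hlA, chainL_length]
  -- second sorting phase
  obtain ⟨T3, l3, hT3, hl3, hs3, hr3⟩ := PTree.sort d _ T2 (by rw [hlen2]; exact hd) hT2
  rw [hlen2] at hr3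
  have hVT1 := R1.vars hV0
  have R2 := hr3.reach (V := V) TA.cnf
    (hlab2.nodup_iff.2 (hr1.labels_perm.nodup_iff.2 hBnodup))
    (fun v hv => hBnotA v (hr1.inner_perm.mem_iff.1 (hinn2 ▸ hv)))
    (by rw [hcnf2]; exact hVT1)
  rw [hcnf2] at R2
  have hl3A : l3 = lA := by
    refine List.Perm.eq_of_pairwise ?_ hs3 (chainL_id_desc (m + 2)) (hl3.trans hperm2)
    intro a b ha hb h1 h2
    have ha' := hlAlt a ((hl3.trans hperm2).mem_iff.1 ha)
    have hb' := hlAlt b hb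
    exact Prod.ext (le_antisymm h2 h1) (ha'.2.trans hb'.2.symm)
  subst hl3A
  obtain ⟨F', hF', hE, R3⟩ := PTree.equate (V := V) hAcomb T3 (TA.cnf ∪ T3.cnf) hT3
    Finset.subset_union_left Finset.subset_union_right hVA
    (fun v hv => hVB v (hr1.labels_perm.mem_iff.1 (hlab2.mem_iff.1
      (hr3.labels_perm.mem_iff.1 hv)))) (R2.vars hVT1)
  rw [hAout, hr3.out_eq, hout2] at hE
  have hVF' := R3.vars (R2.vars hVT1)
  have hU : IsAT F' (∅ : Clause ℕ) := by
    apply UPD.refutes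
    have hu : ∀ i, Holds (F' ∪ clauseNegCNF ∅) ((m + 3, true) : Lit ℕ) (!i) := by
      intro i
      left
      apply UPD.base
      apply Finset.mem_union_left
      apply hE
      rw [mem_E2]
      refine ⟨i, ?_⟩
      cases i <;> simp [lxor]
    exact (hu true).contra (hu false) (by simp)
  refine ⟨insert ∅ F', by simp, ?_⟩
  rw [hF]
  have hlen : lA.length = m + 3 := chainL_length _ _
  rw [hlen] at R3
  refine (((R1.trans R2).trans R3).trans
    (.step (.inl ⟨∅, .inl hU, rfl⟩) ?_ (.refl 0 _))).mono ?_
  · rintro v ⟨C, hC, b, hb⟩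
    rcases Finset.mem_insert.1 hC with rfl | hC
    · simp at hb
    · exact hVF' ⟨C, hC, b, hb⟩
  · apply le_of_eq; ring

/-- There is a constant `K` such that for every `n ≥ 4` and every
permutation `σ` of `{1,…,n}`, the formula `rPar(n, σ)` has a DRAT⁻ refutation, using
no variables other than those of `rPar(n, σ)`, with at most `K·n·log n` lines. -/
theorem rPar_short_drat_refutation :
    ∃ K : ℝ, ∀ n : ℕ, 4 ≤ n → ∀ σ : Equiv.Perm (Fin n),
      ∃ Fs : List (CNF ℕ),
        IsDRATRefutation (rPar n σ) Fs ∧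
        NoNewVars (rPar n σ) Fs ∧
        (Fs.length : ℝ) - 1 ≤ K * n * Real.log n := by
  refine ⟨2000, ?_⟩
  intro n hn σ
  obtain ⟨m, rfl⟩ := Nat.exists_eq_add_of_le' hn
  obtain ⟨G, hG, hR⟩ := main_reach m σ (Nat.log 2 (m + 4) + 1) (by
    have := Nat.lt_pow_succ_log_self (b := 2) (by norm_num) (m + 4)
    simp only [Nat.succ_eq_add_one] at this
    omega)
  obtain ⟨Fs, h1, h2, h3, h4, h5, h6⟩ := hR.toList subset_rfl
  refine ⟨Fs, ⟨h1, h2, h3, G, h4, hG⟩, h5, ?_⟩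
  have hx : (4 : ℝ) ≤ ((m + 4 : ℕ) : ℝ) := by push_cast; linarith [Nat.cast_nonneg (α := ℝ) m]
  have hlog2 := Real.log_two_gt_d9
  have hL4 : Real.log 4 = 2 * Real.log 2 := by
    rw [show (4 : ℝ) = 2 ^ 2 by norm_num, Real.log_pow]; norm_num
  have hL : Real.log 4 ≤ Real.log ((m + 4 : ℕ) : ℝ) := Real.log_le_log (by norm_num) hx
  have hpow : ((2 : ℝ) ^ (Nat.log 2 (m + 4))) ≤ ((m + 4 : ℕ) : ℝ) := by
    have := Nat.pow_log_le_self 2 (show m + 4 ≠ 0 by omega)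
    exact_mod_cast this
  have hlg : (Nat.log 2 (m + 4) : ℝ) * Real.log 2 ≤ Real.log ((m + 4 : ℕ) : ℝ) := by
    rw [← Real.log_pow]
    exact Real.log_le_log (by positivity) hpow
  have h6' : (Fs.length : ℝ) ≤
      256 * ((Nat.log 2 (m + 4) : ℝ) + 1) * ((m : ℝ) + 3) + 6 * ((m : ℝ) + 3) + 1 + 1 := by
    exact_mod_cast h6
  set D : ℝ := (Nat.log 2 (m + 4) : ℝ) with hD
  have hD0 : 0 ≤ D := Nat.cast_nonneg _
  set L : ℝ := Real.log ((m + 4 : ℕ) : ℝ) with hLdef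
  have hm : (0 : ℝ) ≤ m := Nat.cast_nonneg _
  have hL1 : 1 ≤ L := by linarith
  have hDL : D ≤ 2 * L := by nlinarith
  have hb : 256 * (D + 1) + 6 + 1 ≤ 2000 * L := by linarith
  push_cast
  nlinarith [mul_le_mul_of_nonneg_right hb (by linarith : (0 : ℝ) ≤ (m : ℝ) + 4)]
end

section
/- There is a constant K such that for every n ≥ 4 and every permutation σ of {1,…,n}, the formula rPar(n,σ) has an extended resolution refutation with at most K·n·log n lines. -/
variable {ν : Type} [DecidableEq ν]

/-- One of the four clauses (indexed by `b1 b2 : Bool`) of the extension definition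
`v ↔ g(l1, l2)` for a Boolean function `g` of two literals `l1, l2`: the clause ruling
out the assignments where `l1` has value `b1`, `l2` has value `b2`, and `v ≠ g b1 b2`. -/
def defClause (g : Bool → Bool → Bool) (v : ν) (l1 l2 : Lit ν) (b1 b2 : Bool) : Clause ν :=
  {(l1.1, xor l1.2 b1), (l2.1, xor l2.2 b2), (v, g b1 b2)}

/-- An extended resolution derivation from `F`: every clause is a clause of `F`, a
resolvent of two earlier clauses, or an extension clause defining a fresh variable `v`
as a fixed Boolean function `g` of two previously occurring literals (all earlier
occurrences of `v` being among the defining clauses of the same definition). -/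
def IsERDeriv (F : CNF ν) (L : List (Clause ν)) : Prop :=
  ∀ i, (hi : i < L.length) →
    L[i] ∈ F ∨
    (∃ j k, ∃ (hj : j < i) (hk : k < i),
      IsResolvent (L[j]'(hj.trans hi)) (L[k]'(hk.trans hi)) L[i]) ∨
    (∃ (g : Bool → Bool → Bool) (v : ν) (l1 l2 : Lit ν),
      v ∉ cnfVars F ∧ l1.1 ≠ v ∧ l2.1 ≠ v ∧
      (l1.1 ∈ cnfVars F ∨ ∃ j, ∃ (hj : j < i), l1.1 ∈ clauseVars (L[j]'(hj.trans hi))) ∧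
      (l2.1 ∈ cnfVars F ∨ ∃ j, ∃ (hj : j < i), l2.1 ∈ clauseVars (L[j]'(hj.trans hi))) ∧
      (∀ j, (hj : j < i) → v ∈ clauseVars (L[j]'(hj.trans hi)) →
        ∃ b1 b2, L[j]'(hj.trans hi) = defClause g v l1 l2 b1 b2) ∧
      ∃ b1 b2, L[i] = defClause g v l1 l2 b1 b2)

/-- An extended resolution refutation of `F`: an extended resolution derivation ending
with the empty clause; its number of lines is `L.length`. -/
def IsERRefutation (F : CNF ν) (L : List (Clause ν)) : Prop :=
  IsERDeriv F L ∧ L.getLast? = some (∅ : Clause ν)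

namespace RPar

/-- `v` occurs in some line. -/
def Occ (L : List (Clause ℕ)) (v : ℕ) : Prop := ∃ C ∈ L, v ∈ clauseVars C

/-- `C` is a weakening of a line of `L`, or a tautology. -/
def Has (L : List (Clause ℕ)) (C : Clause ℕ) : Prop :=
  (∃ D ∈ L, D ⊆ C) ∨ ∃ v, (v, true) ∈ C ∧ (v, false) ∈ C

theorem Occ.mono {L L' : List (Clause ℕ)} (h : L ⊆ L') {v : ℕ} (ho : Occ L v) : Occ L' v := by
  obtain ⟨C, hC, hv⟩ := ho
  exact ⟨C, h hC, hv⟩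

theorem Has.mono {L L' : List (Clause ℕ)} (h : L ⊆ L') {C : Clause ℕ} (ho : Has L C) :
    Has L' C := by
  rcases ho with ⟨D, hD, hs⟩ | ht
  · exact Or.inl ⟨D, h hD, hs⟩
  · exact Or.inr ht

theorem Has.weaken {L : List (Clause ℕ)} {C C' : Clause ℕ} (ho : Has L C) (h : C ⊆ C') :
    Has L C' := by
  rcases ho with ⟨D, hD, hs⟩ | ⟨v, h1, h2⟩
  · exact Or.inl ⟨D, hD, hs.trans h⟩
  · exact Or.inr ⟨v, h h1, h h2⟩

theorem good_snoc {F : CNF ℕ} {L : List (Clause ℕ)} {C : Clause ℕ} (hL : IsERDeriv F L)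
    (hC : C ∈ F ∨ (∃ A ∈ L, ∃ B ∈ L, IsResolvent A B C) ∨
      (∃ (g : Bool → Bool → Bool) (v : ℕ) (l1 l2 : Lit ℕ),
        v ∉ cnfVars F ∧ l1.1 ≠ v ∧ l2.1 ≠ v ∧ Occ L l1.1 ∧ Occ L l2.1 ∧
        (∀ D ∈ L, v ∈ clauseVars D → ∃ b1 b2, D = defClause g v l1 l2 b1 b2) ∧
        ∃ b1 b2, C = defClause g v l1 l2 b1 b2)) :
    IsERDeriv F (L ++ [C]) := by
  intro i hi
  by_cases hlt : i < L.length
  · have key : ∀ j (hj : j < i), (L ++ [C])[j]'(hj.trans hi) = L[j]'(hj.trans hlt) :=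
      fun j hj => List.getElem_append_left _
    have e : (L ++ [C])[i] = L[i] := List.getElem_append_left _
    rw [e]
    rcases hL i hlt with h | ⟨j, k, hj, hk, h⟩ | ⟨g, v, l1, l2, h1, h2, h3, h4, h5, h6, h7⟩
    · exact Or.inl h
    · refine Or.inr (Or.inl ⟨j, k, hj, hk, ?_⟩)
      rw [key j hj, key k hk]; exact h
    · refine Or.inr (Or.inr ⟨g, v, l1, l2, h1, h2, h3, ?_, ?_, ?_, h7⟩)
      · rcases h4 with h | ⟨j, hj, h⟩
        · exact Or.inl h
        · exact Or.inr ⟨j, hj, by rw [key j hj]; exact h⟩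
      · rcases h5 with h | ⟨j, hj, h⟩
        · exact Or.inl h
        · exact Or.inr ⟨j, hj, by rw [key j hj]; exact h⟩
      · intro j hj
        rw [key j hj]; exact h6 j hj
  · have hi' : i = L.length := by simp at hi; omega
    subst hi'
    have key : ∀ j (hj : j < L.length), (L ++ [C])[j]'(hj.trans hi) = L[j] :=
      fun j hj => List.getElem_append_left _
    have e : (L ++ [C])[L.length] = C := by simp
    rw [e]
    have occ : ∀ w, Occ L w → ∃ j, ∃ (hj : j < L.length),
        w ∈ clauseVars ((L ++ [C])[j]'(hj.trans hi)) := by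
      rintro w ⟨D, hD, hw⟩
      obtain ⟨j, hj, rfl⟩ := List.getElem_of_mem hD
      exact ⟨j, hj, by rw [key j hj]; exact hw⟩
    rcases hC with h | ⟨A, hA, B, hB, h⟩ | ⟨g, v, l1, l2, h1, h2, h3, h4, h5, h6, h7⟩
    · exact Or.inl h
    · obtain ⟨j, hj, rfl⟩ := List.getElem_of_mem hA
      obtain ⟨k, hk, rfl⟩ := List.getElem_of_mem hB
      refine Or.inr (Or.inl ⟨j, k, hj, hk, ?_⟩)
      rw [key j hj, key k hk]; exact h
    · refine Or.inr (Or.inr ⟨g, v, l1, l2, h1, h2, h3, Or.inr (occ _ h4), Or.inr (occ _ h5), ?_, h7⟩)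
      intro j hj
      rw [key j hj]; exact h6 _ (List.getElem_mem hj)

theorem good_init (F : CNF ℕ) : IsERDeriv F F.toList := by
  intro i hi
  exact Or.inl (Finset.mem_toList.1 (List.getElem_mem hi))

/-- `L'` is a valid extension of `L` by at most `k` lines. -/
def Step (F : CNF ℕ) (k : ℕ) (L L' : List (Clause ℕ)) : Prop :=
  IsERDeriv F L' ∧ L ⊆ L' ∧ L'.length ≤ L.length + k

theorem Step.refl {F : CNF ℕ} {L : List (Clause ℕ)} (h : IsERDeriv F L) : Step F 0 L L :=
  ⟨h, fun _ h => h, le_rfl⟩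

theorem Step.trans {F : CNF ℕ} {k k' : ℕ} {L L' L'' : List (Clause ℕ)}
    (h : Step F k L L') (h' : Step F k' L' L'') : Step F (k + k') L L'' :=
  ⟨h'.1, fun _ hx => h'.2.1 (h.2.1 hx), by have := h.2.2; have := h'.2.2; omega⟩

theorem Step.le {F : CNF ℕ} {k k' : ℕ} {L L' : List (Clause ℕ)}
    (h : Step F k L L') (hk : k ≤ k') : Step F k' L L' :=
  ⟨h.1, h.2.1, by have := h.2.2; omega⟩

theorem res1 {F : CNF ℕ} {L : List (Clause ℕ)} (hL : IsERDeriv F L) {C : Clause ℕ} {v : ℕ}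
    (h1 : Has L (insert (v, true) C)) (h2 : Has L (insert (v, false) C)) :
    ∃ L', Step F 1 L L' ∧ Has L' C := by
  have triv : Has L C → ∃ L', Step F 1 L L' ∧ Has L' C :=
    fun h => ⟨L, (Step.refl hL).le (by omega), h⟩
  rcases h1 with ⟨A, hA, hs⟩ | ⟨u, hu1, hu2⟩
  · rcases h2 with ⟨B, hB, ht⟩ | ⟨u, hu1, hu2⟩
    · by_cases hvA : (v, true) ∈ A
      · by_cases hvB : (v, false) ∈ B
        · refine ⟨L ++ [A.erase (v, true) ∪ B.erase (v, false)],
            ⟨good_snoc hL (Or.inr (Or.inl ⟨A, hA, B, hB, v, hvA, hvB, rfl⟩)), by simp, by simp⟩,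
            Or.inl ⟨A.erase (v, true) ∪ B.erase (v, false), by simp, ?_⟩⟩
          apply Finset.union_subset
          · exact Finset.subset_insert_iff.1 hs
          · exact Finset.subset_insert_iff.1 ht
        · exact triv (Or.inl ⟨B, hB, (Finset.subset_insert_iff_of_notMem hvB).1 ht⟩)
      · exact triv (Or.inl ⟨A, hA, (Finset.subset_insert_iff_of_notMem hvA).1 hs⟩)
    · simp only [Finset.mem_insert, Prod.mk.injEq] at hu1 hu2
      rcases hu1 with hu1 | hu1
      · simp at hu1
      · rcases hu2 with hu2 | hu2
        · obtain ⟨rfl, -⟩ := hu2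
          exact triv (Or.inl ⟨A, hA, by rwa [Finset.insert_eq_self.2 hu1] at hs⟩)
        · exact triv (Or.inr ⟨u, hu1, hu2⟩)
  · simp only [Finset.mem_insert, Prod.mk.injEq] at hu1 hu2
    rcases hu2 with hu2 | hu2
    · simp at hu2
    · rcases hu1 with hu1 | hu1
      · obtain ⟨rfl, -⟩ := hu1
        exact triv (by rwa [Finset.insert_eq_self.2 hu2] at h2)
      · exact triv (Or.inr ⟨u, hu1, hu2⟩)

theorem res2 {F : CNF ℕ} {L : List (Clause ℕ)} (hL : IsERDeriv F L) {C : Clause ℕ} (v w : ℕ)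
    (h : ∀ a b, Has L (insert (v, a) (insert (w, b) C))) :
    ∃ L', Step F 3 L L' ∧ Has L' C := by
  obtain ⟨L1, s1, h1⟩ := res1 hL (h true true) (h false true)
  obtain ⟨L2, s2, h2⟩ := res1 s1.1 ((h true false).mono s1.2.1) ((h false false).mono s1.2.1)
  obtain ⟨L3, s3, h3⟩ := res1 s2.1 (h1.mono s2.2.1) h2
  exact ⟨L3, (s1.trans s2).trans s3, h3⟩

theorem res3 {F : CNF ℕ} {L : List (Clause ℕ)} (hL : IsERDeriv F L) {C : Clause ℕ} (u v w : ℕ)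
    (h : ∀ c a b, Has L (insert (u, c) (insert (v, a) (insert (w, b) C)))) :
    ∃ L', Step F 7 L L' ∧ Has L' C := by
  obtain ⟨L1, s1, h1⟩ := res2 hL (C := insert (w, true) C) u v (fun a b => h a b true)
  obtain ⟨L2, s2, h2⟩ := res2 s1.1 (C := insert (w, false) C) u v
    (fun a b => (h a b false).mono s1.2.1)
  obtain ⟨L3, s3, h3⟩ := res1 s2.1 (h1.mono s2.2.1) h2
  exact ⟨L3, (s1.trans s2).trans s3, h3⟩

/-- The constraint `a ⊕ b ⊕ c = d` is available in `L`. -/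
def E3 (L : List (Clause ℕ)) (a b c : ℕ) (d : Bool) : Prop :=
  ∀ α β γ : Bool, (α ^^ β ^^ γ) = d → Has L {(a, α), (b, β), (c, γ)}

theorem E3.mono {L L' : List (Clause ℕ)} (h : L ⊆ L') {a b c : ℕ} {d : Bool}
    (ho : E3 L a b c d) : E3 L' a b c d := fun α β γ e => (ho α β γ e).mono h

theorem E3.swap12 {L : List (Clause ℕ)} {a b c : ℕ} {d : Bool} (h : E3 L a b c d) :
    E3 L b a c d := fun α β γ e =>
  (h β α γ (by rw [← e]; cases α <;> cases β <;> cases γ <;> rfl)).weaken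
    (by intro x; simp; tauto)

theorem E3.swap23 {L : List (Clause ℕ)} {a b c : ℕ} {d : Bool} (h : E3 L a b c d) :
    E3 L a c b d := fun α β γ e =>
  (h α γ β (by rw [← e]; cases α <;> cases β <;> cases γ <;> rfl)).weaken
    (by intro x; simp; tauto)

theorem bool1 : ∀ α β γ a b c d1 d2 d3 : Bool, (α ^^ β ^^ γ) = (d1 ^^ d2 ^^ d3) →
    ¬(a ^^ b ^^ α) = d1 → ¬(b ^^ c ^^ β) = d2 → ¬(a ^^ c ^^ γ) = d3 → False := by
  decide

theorem bool2 : ∀ α β d1 d2 d3 : Bool,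
    (α ^^ β ^^ (α ^^ β ^^ d1 ^^ d2 ^^ d3)) = (d1 ^^ d2 ^^ d3) := by
  decide

theorem bool3 : ∀ α β γ d1 d2 d3 : Bool, (α ^^ β ^^ γ) = (d1 ^^ d2 ^^ d3) →
    γ = (α ^^ β ^^ d1 ^^ d2 ^^ d3) := by
  decide

theorem tri {F : CNF ℕ} {L : List (Clause ℕ)} (hL : IsERDeriv F L) {x y z p q r : ℕ}
    {d1 d2 d3 : Bool} (h1 : E3 L x y p d1) (h2 : E3 L y z q d2) (h3 : E3 L x z r d3) :
    ∃ L', Step F 28 L L' ∧ E3 L' p q r (d1 ^^ d2 ^^ d3) := by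
  have main : ∀ α β γ : Bool, (α ^^ β ^^ γ) = (d1 ^^ d2 ^^ d3) → ∀ a b c,
      Has L (insert (x, a) (insert (y, b) (insert (z, c) {(p, α), (q, β), (r, γ)}))) := by
    intro α β γ e a b c
    by_cases e1 : (a ^^ b ^^ α) = d1
    · exact (h1 _ _ _ e1).weaken (by intro x; simp; tauto)
    by_cases e2 : (b ^^ c ^^ β) = d2
    · exact (h2 _ _ _ e2).weaken (by intro x; simp; tauto)
    by_cases e3 : (a ^^ c ^^ γ) = d3
    · exact (h3 _ _ _ e3).weaken (by intro x; simp; tauto)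
    exfalso
    exact bool1 _ _ _ _ _ _ _ _ _ e e1 e2 e3
  have one : ∀ (L1 : List (Clause ℕ)), L ⊆ L1 → IsERDeriv F L1 → ∀ α β : Bool,
      ∃ L', Step F 7 L1 L' ∧
        Has L' {(p, α), (q, β), (r, (α ^^ β ^^ d1 ^^ d2 ^^ d3))} := by
    intro L1 hs hL1 α β
    apply res3 hL1 x y z
    intro a b c
    exact (main α β _ (bool2 _ _ _ _ _) a b c).mono hs
  obtain ⟨L1, s1, k1⟩ := one L (fun _ h => h) hL true true
  obtain ⟨L2, s2, k2⟩ := one L1 s1.2.1 s1.1 true false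
  have s12 := s1.trans s2
  obtain ⟨L3, s3, k3⟩ := one L2 s12.2.1 s2.1 false true
  have s13 := s12.trans s3
  obtain ⟨L4, s4, k4⟩ := one L3 s13.2.1 s3.1 false false
  have s14 := s13.trans s4
  refine ⟨L4, s14, ?_⟩
  intro α β γ e
  have eγ : γ = (α ^^ β ^^ d1 ^^ d2 ^^ d3) := bool3 _ _ _ _ _ _ e
  subst eγ
  cases α <;> cases β
  · exact k4
  · exact k3.mono s4.2.1
  · exact k2.mono (s3.trans s4).2.1
  · exact k1.mono ((s2.trans s3).trans s4).2.1

theorem exists_fresh (F : CNF ℕ) (L : List (Clause ℕ)) : ∃ v, v ∉ cnfVars F ∧ ¬ Occ L v := by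
  classical
  obtain ⟨v, hv⟩ := Infinite.exists_notMem_finset
    ((F.biUnion fun C => C.image Prod.fst) ∪ (L.toFinset.biUnion fun C => C.image Prod.fst))
  refine ⟨v, ?_, ?_⟩
  · rintro ⟨C, hC, b, hb⟩
    apply hv
    simp only [Finset.mem_union, Finset.mem_biUnion, Finset.mem_image]
    exact Or.inl ⟨C, hC, _, hb, rfl⟩
  · rintro ⟨C, hC, b, hb⟩
    apply hv
    simp only [Finset.mem_union, Finset.mem_biUnion, Finset.mem_image]
    exact Or.inr ⟨C, by simpa using hC, _, hb, rfl⟩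

theorem extend {F : CNF ℕ} {L : List (Clause ℕ)} (hL : IsERDeriv F L) {a b : ℕ}
    (ha : Occ L a) (hb : Occ L b) :
    ∃ L' v, Step F 4 L L' ∧ Occ L' v ∧ E3 L' a b v false := by
  obtain ⟨v, hv, hv'⟩ := exists_fresh F L
  have hav : a ≠ v := by rintro rfl; exact hv' ha
  have hbv : b ≠ v := by rintro rfl; exact hv' hb
  let dc := defClause xor v (a, true) (b, true)
  have one : ∀ L1 : List (Clause ℕ), IsERDeriv F L1 → L ⊆ L1 →
      (∀ D ∈ L1, v ∈ clauseVars D → ∃ b1 b2, D = dc b1 b2) → ∀ b1 b2,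
      IsERDeriv F (L1 ++ [dc b1 b2]) ∧ L ⊆ L1 ++ [dc b1 b2] ∧
      (∀ D ∈ L1 ++ [dc b1 b2], v ∈ clauseVars D → ∃ b1 b2, D = dc b1 b2) := by
    intro L1 hL1 hs hd b1 b2
    refine ⟨good_snoc hL1 (Or.inr (Or.inr ⟨xor, v, (a, true), (b, true), hv, hav, hbv,
      ha.mono hs, hb.mono hs, hd, b1, b2, rfl⟩)), ?_, ?_⟩
    · intro x hx; simp [hs hx]
    · intro D hD hvD
      simp only [List.mem_append, List.mem_singleton] at hD
      rcases hD with hD | hD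
      · exact hd D hD hvD
      · exact ⟨b1, b2, hD⟩
  obtain ⟨g1, i1, d1⟩ := one L hL (fun _ h => h) (fun D hD h => absurd ⟨D, hD, h⟩ hv') true true
  obtain ⟨g2, i2, d2⟩ := one _ g1 i1 d1 true false
  obtain ⟨g3, i3, d3⟩ := one _ g2 i2 d2 false true
  obtain ⟨g4, i4, d4⟩ := one _ g3 i3 d3 false false
  refine ⟨_, v, ⟨g4, i4, by simp⟩, ⟨dc true true, by simp, ?_⟩, ?_⟩
  · exact ⟨false, by simp [dc, defClause]⟩
  · intro α β γ e
    refine Or.inl ⟨dc (!α) (!β), ?_, ?_⟩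
    · cases α <;> cases β <;> simp
    · have : γ = (α ^^ β) := by revert e; revert α β γ; clear * -; decide
      subst this
      cases α <;> cases β <;> simp [dc, defClause]

/-- `L` contains a chain of parity constraints from `p` through the list to `r`. -/
inductive Chain (L : List (Clause ℕ)) : ℕ → List ℕ → ℕ → Bool → Prop
  | nil (p : ℕ) : Chain L p [] p false
  | cons {p w q r : ℕ} {l : List ℕ} {d D : Bool} :
      E3 L p w q d → Chain L q l r D → Chain L p (w :: l) r (d ^^ D)

theorem Chain.mono {L L' : List (Clause ℕ)} (h : L ⊆ L') {p r : ℕ} {l : List ℕ} {D : Bool}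
    (hc : Chain L p l r D) : Chain L' p l r D := by
  induction hc with
  | nil p => exact Chain.nil p
  | cons h1 _ ih => exact Chain.cons (h1.mono h) ih

theorem Chain.split {L : List (Clause ℕ)} {r : ℕ} {l1 l2 : List ℕ} : ∀ {p : ℕ} {D : Bool},
    Chain L p (l1 ++ l2) r D →
    ∃ m D1 D2, Chain L p l1 m D1 ∧ Chain L m l2 r D2 ∧ D = (D1 ^^ D2) := by
  induction l1 with
  | nil => intro p D h; exact ⟨p, false, D, Chain.nil p, h, by simp⟩
  | cons w l ih =>
    intro p D h
    cases h with
    | cons h1 h2 =>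
      obtain ⟨m, D1, D2, c1, c2, e⟩ := ih h2
      exact ⟨m, _, D2, Chain.cons h1 c1, c2, by rw [e, Bool.xor_assoc]⟩

theorem merge_step {F : CNF ℕ} {L : List (Clause ℕ)} (hL : IsERDeriv F L) {a b c w a' : ℕ}
    {δ d : Bool} (hw : Occ L w) (hc : Occ L c) (h : E3 L a b c δ) (h1 : E3 L a w a' d) :
    ∃ L' c', Step F 32 L L' ∧ Occ L' c' ∧ E3 L' c w c' false ∧ E3 L' a' b c' (δ ^^ d) := by
  obtain ⟨L1, c', s1, o1, e1⟩ := extend hL hc hw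
  obtain ⟨L2, s2, e2⟩ := tri s1.1 (h.mono s1.2.1).swap23 e1 (h1.mono s1.2.1)
  refine ⟨L2, c', s1.trans s2, o1.mono s2.2.1, e1.mono s2.2.1, ?_⟩
  rw [show (δ ^^ d) = (δ ^^ false ^^ d) by simp]
  exact e2.swap23.swap12

theorem merge_chain {F : CNF ℕ} : ∀ (N : ℕ) (l1 l2 : List ℕ), l1.length + l2.length = N →
    l1.Pairwise (· ≤ ·) → l2.Pairwise (· ≤ ·) →
    ∀ {L : List (Clause ℕ)} {a b c e1 e2 : ℕ} {δ D1 D2 : Bool}, IsERDeriv F L →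
    (∀ w ∈ l1, Occ L w) → (∀ w ∈ l2, Occ L w) → Occ L c → E3 L a b c δ →
    Chain L a l1 e1 D1 → Chain L b l2 e2 D2 →
    ∃ L' l e, Step F (32 * N) L L' ∧ l.Perm (l1 ++ l2) ∧ l.Pairwise (· ≤ ·) ∧
      Chain L' c l e false ∧ E3 L' e1 e2 e (δ ^^ D1 ^^ D2) := by
  intro N
  induction N with
  | zero =>
    intro l1 l2 hN _ _ L a b c e1 e2 δ D1 D2 hL _ _ _ h c1 c2
    have h1 : l1 = [] := List.length_eq_zero_iff.1 (by omega)
    have h2 : l2 = [] := List.length_eq_zero_iff.1 (by omega)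
    subst h1 h2
    cases c1; cases c2
    exact ⟨L, [], c, Step.refl hL, by simp, by simp, Chain.nil c, by simpa using h⟩
  | succ N ih =>
    have left : ∀ (w : ℕ) (l1 l2 : List ℕ), (w :: l1).length + l2.length = N + 1 →
        (w :: l1).Pairwise (· ≤ ·) → l2.Pairwise (· ≤ ·) → (∀ x ∈ l2, w ≤ x) →
        ∀ {L : List (Clause ℕ)} {a b c e1 e2 : ℕ} {δ D1 D2 : Bool}, IsERDeriv F L →
        (∀ x ∈ (w :: l1), Occ L x) → (∀ x ∈ l2, Occ L x) → Occ L c → E3 L a b c δ →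
        Chain L a (w :: l1) e1 D1 → Chain L b l2 e2 D2 →
        ∃ L' l e, Step F (32 * (N + 1)) L L' ∧ l.Perm ((w :: l1) ++ l2) ∧ l.Pairwise (· ≤ ·) ∧
          Chain L' c l e false ∧ E3 L' e1 e2 e (δ ^^ D1 ^^ D2) := by
      intro w l1 l2 hN p1 p2 hw L a b c e1 e2 δ D1 D2 hL o1 o2 oc h c1 c2
      cases c1 with
      | @cons _ _ a' _ _ d D h1 c1 =>
        obtain ⟨L1, c', s1, oc', k1, k2⟩ := merge_step hL (o1 w (by simp)) oc h h1
        rw [List.pairwise_cons] at p1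
        obtain ⟨L2, l, e, s2, pm, so, ch, k3⟩ := ih l1 l2 (by simp at hN; omega) p1.2 p2 s1.1
          (fun x hx => (o1 x (by simp [hx])).mono s1.2.1) (fun x hx => (o2 x hx).mono s1.2.1)
          oc' k2 (c1.mono s1.2.1) (c2.mono s1.2.1)
        refine ⟨L2, w :: l, e, (s1.trans s2).le (by omega), by simpa using pm, ?_, ?_, ?_⟩
        · rw [List.pairwise_cons]
          refine ⟨fun x hx => ?_, so⟩
          have := pm.mem_iff.1 hx
          rw [List.mem_append] at this
          rcases this with hx | hx
          · exact p1.1 x hx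
          · exact hw x hx
        · exact Chain.cons (k1.mono s2.2.1) ch
        · rw [show (δ ^^ (d ^^ D) ^^ D2) = (δ ^^ d ^^ D ^^ D2) by simp]
          exact k3
    intro l1 l2 hN p1 p2 L a b c e1 e2 δ D1 D2 hL o1 o2 oc h c1 c2
    by_cases hcase : ∃ w l, l1 = w :: l ∧ ∀ x ∈ l2, w ≤ x
    · obtain ⟨w, l, rfl, hw⟩ := hcase
      exact left w l l2 hN p1 p2 hw hL o1 o2 oc h c1 c2
    · have : ∃ w l, l2 = w :: l ∧ ∀ x ∈ l1, w ≤ x := by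
        cases l2 with
        | nil =>
          cases l1 with
          | nil => simp at hN
          | cons w l => exact absurd ⟨w, l, rfl, by simp⟩ hcase
        | cons v l' =>
          refine ⟨v, l', rfl, ?_⟩
          cases l1 with
          | nil => simp
          | cons w l =>
            rw [List.pairwise_cons] at p1 p2
            have hvw : v ≤ w := by
              by_contra hlt
              apply hcase
              refine ⟨w, l, rfl, ?_⟩
              intro x hx
              rcases List.mem_cons.1 hx with rfl | hx
              · omega
              · have := p2.1 x hx; omega
            intro x hx
            rcases List.mem_cons.1 hx with rfl | hx
            · exact hvw
            · exact hvw.trans (p1.1 x hx)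
      obtain ⟨w, l, rfl, hw⟩ := this
      obtain ⟨L', l', e, s, pm, so, ch, k⟩ :=
        left w l l1 (by omega) p2 p1 hw hL o2 o1 oc h.swap12 c2 c1
      refine ⟨L', l', e, s, pm.trans List.perm_append_comm, so, ch, ?_⟩
      rw [show (δ ^^ D1 ^^ D2) = (δ ^^ D2 ^^ D1) by
        cases δ <;> cases D1 <;> cases D2 <;> rfl]
      exact k.swap12

/-- `z` is a constant-false variable. -/
def Zero (L : List (Clause ℕ)) (z : ℕ) : Prop := Occ L z ∧ Has L {(z, false)}

theorem Zero.mono {L L' : List (Clause ℕ)} (h : L ⊆ L') {z : ℕ} (hz : Zero L z) : Zero L' z :=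
  ⟨hz.1.mono h, hz.2.mono h⟩

theorem Zero.e3 {L : List (Clause ℕ)} {z : ℕ} (hz : Zero L z) (a : ℕ) : E3 L z a a false := by
  intro α β γ e
  cases α
  · exact hz.2.weaken (by simp)
  · right
    refine ⟨a, ?_⟩
    cases β <;> cases γ <;> simp at e ⊢

theorem sort_chain {F : CNF ℕ} {z : ℕ} : ∀ (k : ℕ) (l : List ℕ), l.length ≤ 2 ^ k →
    ∀ {L : List (Clause ℕ)} {p r : ℕ} {D : Bool}, IsERDeriv F L → Zero L z →
    (∀ w ∈ l, Occ L w) → Chain L p l r D →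
    ∃ L' l' e, Step F (60 * k * l.length) L L' ∧ l'.Perm l ∧ l'.Pairwise (· ≤ ·) ∧
      Chain L' z l' e false ∧ E3 L' p e r D := by
  intro k
  have base : ∀ (k : ℕ) (l : List ℕ), l.length ≤ 1 →
    ∀ {L : List (Clause ℕ)} {p r : ℕ} {D : Bool}, IsERDeriv F L → Zero L z →
    (∀ w ∈ l, Occ L w) → Chain L p l r D →
    ∃ L' l' e, Step F (60 * k * l.length) L L' ∧ l'.Perm l ∧ l'.Pairwise (· ≤ ·) ∧
      Chain L' z l' e false ∧ E3 L' p e r D := by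
    intro k l hl L p r D hL hz ho hc
    cases hc with
    | nil => exact ⟨L, [], z, (Step.refl hL).le (by omega), by simp, by simp, Chain.nil z,
        (hz.e3 p).swap12⟩
    | @cons _ w q _ l d D h1 hc =>
      cases hc with
      | nil =>
        refine ⟨L, [w], w, (Step.refl hL).le (by omega), by simp, by simp,
          Chain.cons (hz.e3 w) (Chain.nil w), by simpa using h1⟩
      | cons _ _ => simp at hl
  induction k with
  | zero => intro l hl; exact base 0 l (by simpa using hl)
  | succ k ih =>
    intro l hl L p r D hL hz ho hc
    by_cases h1 : l.length ≤ 1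
    · exact base (k + 1) l h1 hL hz ho hc
    · obtain ⟨l1, l2, rfl, hl1, hl2⟩ : ∃ l1 l2, l = l1 ++ l2 ∧ l1.length ≤ 2 ^ k ∧
          l2.length ≤ 2 ^ k := by
        refine ⟨l.take (2 ^ k), l.drop (2 ^ k), by simp, by simp, ?_⟩
        rw [List.length_drop]
        rw [pow_succ] at hl
        omega
      obtain ⟨m, D1, D2, c1, c2, rfl⟩ := hc.split
      obtain ⟨L1, l1', e1, s1, pm1, so1, ch1, k1⟩ := ih l1 hl1 hL hz
        (fun w hw => ho w (by simp [hw])) c1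
      obtain ⟨L2, l2', e2, s2, pm2, so2, ch2, k2⟩ := ih l2 hl2 s1.1 (hz.mono s1.2.1)
        (fun w hw => (ho w (by simp [hw])).mono s1.2.1) (c2.mono s1.2.1)
      have s12 := s1.trans s2
      have hz2 := hz.mono s12.2.1
      obtain ⟨L3, l3, e, s3, pm3, so3, ch3, k3⟩ := merge_chain _ l1' l2' rfl so1 so2 s2.1
        (fun w hw => (ho w (by simp [pm1.mem_iff.1 hw])).mono s12.2.1)
        (fun w hw => (ho w (by simp [pm2.mem_iff.1 hw])).mono s12.2.1)
        hz2.1 (hz2.e3 z) (ch1.mono s2.2.1) ch2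
      obtain ⟨L4, s4, k4⟩ := tri s3.1 (k1.mono (s2.trans s3).2.1).swap12.swap23
        (k2.mono s3.2.1) k3
      refine ⟨L4, l3, e, ((s12.trans s3).trans s4).le ?_, pm3.trans (pm1.append pm2), so3,
        ch3.mono s4.2.1, ?_⟩
      · rw [pm1.length_eq, pm2.length_eq]
        rw [List.length_append] at h1 ⊢
        nlinarith
      · rw [show (D1 ^^ D2) = (D1 ^^ D2 ^^ (false ^^ false ^^ false)) by simp]
        exact k4.swap23

theorem compare {F : CNF ℕ} {z : ℕ} : ∀ (l : List ℕ) {L : List (Clause ℕ)} {a b e1 e2 : ℕ}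
    {δ D1 D2 : Bool}, IsERDeriv F L → E3 L a b z δ → Chain L a l e1 D1 → Chain L b l e2 D2 →
    ∃ L', Step F (28 * l.length) L L' ∧ E3 L' e1 e2 z (δ ^^ D1 ^^ D2) := by
  intro l
  induction l with
  | nil =>
    intro L a b e1 e2 δ D1 D2 hL h c1 c2
    cases c1; cases c2
    exact ⟨L, Step.refl hL, by simpa using h⟩
  | cons w l ih =>
    intro L a b e1 e2 δ D1 D2 hL h c1 c2
    cases c1 with
    | @cons _ _ a' _ _ d D h1 c1 =>
    cases c2 with
    | @cons _ _ b' _ _ d' D' h2 c2 =>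
      obtain ⟨L1, s1, k1⟩ := tri hL h h2 h1
      obtain ⟨L2, s2, k2⟩ := ih s1.1 k1.swap12.swap23.swap12
        (c1.mono s1.2.1) (c2.mono s1.2.1)
      refine ⟨L2, (s1.trans s2).le (by simp; omega), ?_⟩
      rw [show (δ ^^ (d ^^ D) ^^ (d' ^^ D')) = (δ ^^ d' ^^ d ^^ D ^^ D') by
        cases δ <;> cases d <;> cases D <;> cases d' <;> cases D' <;> rfl]
      exact k2

theorem mk_zero {F : CNF ℕ} {L : List (Clause ℕ)} (hL : IsERDeriv F L) {a : ℕ}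
    (ha : Occ L a) : ∃ L' z, Step F 5 L L' ∧ Zero L' z := by
  obtain ⟨L1, z, s1, o1, h1⟩ := extend hL ha ha
  obtain ⟨L2, s2, h2⟩ := res1 s1.1 (C := {(z, false)}) (v := a)
    ((h1 true true false rfl).weaken (by intro x; simp))
    ((h1 false false false rfl).weaken (by intro x; simp))
  exact ⟨L2, z, s1.trans s2, o1.mono s2.2.1, h2⟩

/-- From the two chains, the empty clause. -/
theorem refute {F : CNF ℕ} {z : ℕ} (k : ℕ) (l l' : List ℕ) (hlen : l.length ≤ 2 ^ k)
    (hp : l'.Perm l) (hs : l'.Pairwise (· ≤ ·)) {L : List (Clause ℕ)} (hL : IsERDeriv F L)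
    (hz : Zero L z) (ho : ∀ w ∈ l, Occ L w) (h1 : Chain L z l' z false)
    (h2 : Chain L z l z true) :
    ∃ L', Step F (60 * k * l.length + 28 * l.length + 3) L L' ∧ (∅ : Clause ℕ) ∈ L' := by
  obtain ⟨L1, l1, e, s1, pm, so, ch, k1⟩ := sort_chain k l hlen hL hz ho h2
  have : l1 = l' := by
    exact (pm.trans hp.symm).eq_of_pairwise (fun a b _ _ h h' => le_antisymm h h') so hs
  subst this
  have hz1 := hz.mono s1.2.1
  obtain ⟨L2, s2, k2⟩ := compare l1 s1.1 (hz1.e3 z) (h1.mono s1.2.1) ch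
  have hz2 := hz1.mono s2.2.1
  obtain ⟨L3, s3, k3⟩ := res2 s2.1 (C := ∅) z e (by
    intro α β
    cases α
    · exact hz2.2.weaken (by simp)
    · cases β
      · exact (k2 true false true (by simp)).weaken (by intro x; simp; tauto)
      · exact ((k1.mono s2.2.1) true true true (by simp)).weaken (by intro x; simp; tauto))
  refine ⟨L3, ((s1.trans s2).trans s3).le (by rw [hp.length_eq]), ?_⟩
  rcases k3 with ⟨D, hD, hs⟩ | ⟨v, hv, -⟩
  · rwa [Finset.subset_empty.1 hs] at hD
  · simp at hv

/-- Parity of the number of `true` among `s 0, …, s (n-1)`. -/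
def X (s : ℕ → Bool) (n : ℕ) : Bool := ((List.range n).map s).foldr xor false

theorem chain_of_fun {L : List (Clause ℕ)} : ∀ (n : ℕ) (u w : ℕ → ℕ) (e s : ℕ → Bool),
    (∀ i < n, E3 L (u i) (w i) (u (i + 1)) (e i ^^ s i ^^ e (i + 1))) →
    Chain L (u 0) ((List.range n).map w) (u n) (e 0 ^^ e n ^^ X s n) := by
  intro n
  induction n with
  | zero =>
    intro u w e s _
    simpa [X] using Chain.nil (u 0)
  | succ n ih =>
    intro u w e s h
    have h0 := h 0 (by omega)
    have := ih (fun i => u (i + 1)) (fun i => w (i + 1)) (fun i => e (i + 1)) (fun i => s (i + 1))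
      (fun i hi => h (i + 1) (by omega))
    have hc := Chain.cons h0 this
    have e1 : (List.range (n + 1)).map w = w 0 :: (List.range n).map (fun i => w (i + 1)) := by
      rw [List.range_succ_eq_map]; simp [Function.comp_def]
    have e2 : X s (n + 1) = (s 0 ^^ X (fun i => s (i + 1)) n) := by
      unfold X
      rw [List.range_succ_eq_map]; simp [Function.comp_def]
    rw [e1, e2]
    convert hc using 1
    generalize X (fun i => s (i + 1)) n = x
    generalize e (n + 1) = y
    generalize e (0 + 1) = y'
    generalize e 0 = y''
    generalize s 0 = y3
    revert x y y' y'' y3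
    decide

theorem bool4 : ∀ α β γ s1 s2 s3 : Bool, (α ^^ β ^^ γ) = (!s1 ^^ !s2 ^^ !s3) →
    (Finset.univ.filter
      (fun i : Fin 3 => (![s1 ^^ α, s2 ^^ β, s3 ^^ γ] : Fin 3 → Bool) i = true)).card % 2 = 1 := by
  decide

theorem image_fin3 (h : Fin 3 → Lit ℕ) :
    (Finset.univ : Finset (Fin 3)).image h = {h 0, h 1, h 2} := by
  ext x
  simp only [Finset.mem_image, Finset.mem_univ, true_and, Finset.mem_insert,
    Finset.mem_singleton]
  constructor
  · rintro ⟨i, rfl⟩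
    fin_cases i <;> simp
  · rintro (h | h | h)
    exacts [⟨0, h.symm⟩, ⟨1, h.symm⟩, ⟨2, h.symm⟩]

theorem xor_mem (l1 l2 l3 : Lit ℕ) (α β γ : Bool)
    (h : (α ^^ β ^^ γ) = (!l1.2 ^^ !l2.2 ^^ !l3.2)) :
    ({(l1.1, α), (l2.1, β), (l3.1, γ)} : Clause ℕ) ∈ xorCNF [l1, l2, l3] := by
  unfold xorCNF parityCNF
  rw [Finset.mem_image]
  refine ⟨(![l1.2 ^^ α, l2.2 ^^ β, l3.2 ^^ γ] : Fin 3 → Bool), ?_, ?_⟩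
  · rw [Finset.mem_filter]
    exact ⟨Finset.mem_univ _, bool4 _ _ _ _ _ _ h⟩
  · have key : ∀ (l : Lit ℕ) (a : Bool),
        (if (l.2 ^^ a) = true then negLit l else l) = (l.1, a) := by
      rintro ⟨v, s⟩ a
      cases s <;> cases a <;> simp [negLit]
    rw [← key l1 α, ← key l2 β, ← key l3 γ]
    exact image_fin3 _

theorem e3_of_xor {L : List (Clause ℕ)} {l1 l2 l3 : Lit ℕ}
    (h : ∀ C ∈ xorCNF [l1, l2, l3], C ∈ L) :
    E3 L l1.1 l2.1 l3.1 (!l1.2 ^^ !l2.2 ^^ !l3.2) ∧ Occ L l1.1 ∧ Occ L l2.1 ∧ Occ L l3.1 := by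
  have hm := xor_mem l1 l2 l3 (!l1.2) (!l2.2) (!l3.2) rfl
  refine ⟨fun α β γ e => Or.inl ⟨_, h _ (xor_mem l1 l2 l3 α β γ e), Finset.Subset.refl _⟩,
    ⟨_, h _ hm, !l1.2, by simp⟩, ⟨_, h _ hm, !l2.2, by simp⟩, ⟨_, h _ hm, !l3.2, by simp⟩⟩

theorem ctr {L : List (Clause ℕ)} {xs : List (Lit ℕ)} {t : ℕ → ℕ}
    (h : ∀ C ∈ ParityCNF xs t, C ∈ L) {j : ℕ} (hj : j < xs.length - 2) :
    ∀ C ∈ xorCNF (parityCtr xs t j), C ∈ L := by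
  intro C hC
  apply h
  unfold ParityCNF
  rw [Finset.mem_biUnion]
  exact ⟨j, Finset.mem_range.2 hj, hC⟩

theorem parity_occ {L : List (Clause ℕ)} {xs : List (Lit ℕ)} {t : ℕ → ℕ} (hn : 4 ≤ xs.length)
    (h : ∀ C ∈ ParityCNF xs t, C ∈ L) (i : ℕ) (hi : i < xs.length) :
    Occ L (xs.getD i (t 0, true)).1 := by
  by_cases h0 : i ≤ 1
  · have := ctr h (j := 0) (by omega)
    rw [parityCtr, if_pos rfl] at this
    obtain ⟨-, h1, h2, -⟩ := e3_of_xor this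
    interval_cases i
    · exact h1
    · exact h2
  by_cases h1 : i < xs.length - 2
  · have := ctr h (j := i - 1) (by omega)
    rw [parityCtr, if_neg (by omega), if_pos (by omega)] at this
    obtain ⟨-, -, h2, -⟩ := e3_of_xor this
    rwa [show i - 1 + 1 = i by omega] at h2
  · have := ctr h (j := xs.length - 3) (by omega)
    rw [parityCtr, if_neg (by omega), if_neg (by omega)] at this
    obtain ⟨-, -, h2, h3⟩ := e3_of_xor this
    rcases (show i = xs.length - 2 ∨ i = xs.length - 1 by omega) with rfl | rfl
    · exact h2
    · exact h3

theorem parity_chain {L : List (Clause ℕ)} {z : ℕ} (hz : Zero L z) {xs : List (Lit ℕ)}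
    {t : ℕ → ℕ} (n : ℕ) (hlen : xs.length = n) (hn : 4 ≤ n) (h : ∀ C ∈ ParityCNF xs t, C ∈ L) :
    Chain L z ((List.range n).map (fun i => (xs.getD i (t 0, true)).1)) z
      (X (fun i => !(xs.getD i (t 0, true)).2) n) := by
  set y : ℕ → Lit ℕ := fun i => xs.getD i (t 0, true) with hy
  let u : ℕ → ℕ := fun i => if i = 0 ∨ i = n then z else if i = 1 then (y 0).1 else
    if i = n - 1 then (y (n - 1)).1 else t (i - 2)
  let e : ℕ → Bool := fun i => if i = 1 then !(y 0).2 else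
    if i = n - 1 then !(y (n - 1)).2 else false
  have key := chain_of_fun (L := L) n u (fun i => (y i).1) e (fun i => !(y i).2) ?_
  · have u0 : u 0 = z := by simp [u]
    have un : u n = z := by simp [u]
    have e0 : e 0 = false := by simp only [e]; rw [if_neg (by omega), if_neg (by omega)]
    have en : e n = false := by simp only [e]; rw [if_neg (by omega), if_neg (by omega)]
    rw [u0, un, e0, en] at key
    simp only [Bool.false_bne] at key
    exact key
  intro i hi
  have u0 : u 0 = z := by simp [u]
  have un : u n = z := by simp [u]
  have u1 : u 1 = (y 0).1 := by simp only [u]; rw [if_neg (by omega)]; simp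
  have un1 : u (n - 1) = (y (n - 1)).1 := by
    simp only [u]; rw [if_neg (by omega), if_neg (by omega)]; simp
  have um : ∀ k, k + 4 ≤ n → u (k + 2) = t k := by
    intro k hk
    simp only [u]; rw [if_neg (by omega), if_neg (by omega), if_neg (by omega)]; simp
  have e1 : e 1 = !(y 0).2 := by simp [e]
  have en1 : e (n - 1) = !(y (n - 1)).2 := by
    simp only [e]; rw [if_neg (by omega)]; simp
  have em : ∀ k, k ≠ 1 → k ≠ n - 1 → e k = false := by
    intro k hk hk'
    simp only [e]; rw [if_neg hk, if_neg hk']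
  have hxy : ∀ i, xs.getD i (t 0, true) = y i := fun i => rfl
  rcases (show i = 0 ∨ i = 1 ∨ (2 ≤ i ∧ i ≤ n - 3) ∨ i = n - 2 ∨ i = n - 1 by omega) with
    rfl | rfl | hi' | rfl | rfl
  · rw [u0, u1, e1, em 0 (by omega) (by omega)]
    simpa using hz.e3 (y 0).1
  · have := ctr h (j := 0) (by omega)
    rw [parityCtr, if_pos rfl, hxy, hxy] at this
    have := (e3_of_xor this).1
    rw [u1, um 0 (by omega), e1, em 2 (by omega) (by omega)]
    simpa using this
  · have := ctr h (j := i - 1) (by omega)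
    obtain ⟨k, rfl⟩ : ∃ k, i = k + 2 := ⟨i - 2, by omega⟩
    rw [parityCtr, if_neg (by omega), if_pos (by omega), hxy] at this
    have := (e3_of_xor this).1
    rw [um k (by omega), show k + 2 + 1 = (k + 1) + 2 by omega, um (k + 1) (by omega),
      em (k + 2) (by omega) (by omega), em (k + 1 + 2) (by omega) (by omega)]
    simpa using this
  · have := ctr h (j := n - 3) (by omega)
    rw [parityCtr, if_neg (by omega), if_neg (by omega), hxy, hxy, hlen] at this
    have := (e3_of_xor this).1
    rw [show n - 2 + 1 = n - 1 by omega, un1, en1, em (n - 2) (by omega) (by omega),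
      show u (n - 2) = t (n - 4) by
        have := um (n - 4) (by omega)
        rwa [show n - 4 + 2 = n - 2 by omega] at this]
    simpa using this
  · rw [show n - 1 + 1 = n by omega, un, un1, en1, em n (by omega) (by omega)]
    simpa using (hz.e3 (y (n - 1)).1).swap12.swap23

theorem foldr_false (l : List ℕ) (f : ℕ → Bool) (b : Bool) (h : ∀ x ∈ l, f x = false) :
    (l.map f).foldr xor b = b := by
  induction l with
  | nil => rfl
  | cons a l ih =>
    have h1 := ih (fun x hx => h x (by simp [hx]))
    simp only [List.map_cons, List.foldr_cons, h1, h a (by simp)]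
    simp

theorem deriv_take {F : CNF ℕ} {L : List (Clause ℕ)} (h : IsERDeriv F L) (m : ℕ) :
    IsERDeriv F (L.take m) := by
  intro i hi
  have hi' : i < L.length := by simp at hi; omega
  have := h i hi'
  simp only [List.getElem_take]
  exact this

theorem card_parity (xs : List (Lit ℕ)) (t : ℕ → ℕ) :
    (ParityCNF xs t).card ≤ 8 * xs.length := by
  unfold ParityCNF
  refine Finset.card_biUnion_le.trans ?_
  have : ∀ j ∈ Finset.range (xs.length - 2), (xorCNF (parityCtr xs t j)).card ≤ 8 := by
    intro j _
    unfold xorCNF parityCNF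
    refine Finset.card_image_le.trans ((Finset.card_filter_le _ _).trans ?_)
    have h3 : (parityCtr xs t j).length = 3 := by
      unfold parityCtr
      split_ifs <;> rfl
    simp [h3]
  refine (Finset.sum_le_card_nsmul _ _ 8 this).trans ?_
  simp
  omega

theorem clog_bound (n : ℕ) (hn : 4 ≤ n) : (Nat.clog 2 n : ℝ) ≤ 3 * Real.log n := by
  have h4 : (4 : ℝ) ≤ n := by exact_mod_cast hn
  have hlog2 := Real.log_two_gt_d9
  have l4 : Real.log 4 = 2 * Real.log 2 := by
    rw [show (4 : ℝ) = 2 ^ 2 by norm_num, Real.log_pow]; norm_num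
  have hl4 : Real.log 4 ≤ Real.log n := Real.log_le_log (by norm_num) h4
  have hk : 2 ^ (Nat.clog 2 n - 1) < n := Nat.pow_pred_clog_lt_self (by norm_num) (by omega)
  have hk' : (2 : ℝ) ^ (Nat.clog 2 n - 1) ≤ n := by exact_mod_cast hk.le
  have := Real.log_le_log (by positivity) hk'
  rw [Real.log_pow] at this
  have hc : (Nat.clog 2 n : ℝ) ≤ ((Nat.clog 2 n - 1 : ℕ) : ℝ) + 1 := by
    exact_mod_cast (by omega : Nat.clog 2 n ≤ (Nat.clog 2 n - 1) + 1)
  have hnn : (0 : ℝ) ≤ ((Nat.clog 2 n - 1 : ℕ) : ℝ) := by positivity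
  nlinarith

theorem listA_get (n i d : ℕ) (hi : i < n) :
    (xListA n).getD i (d, true) = (i, true) := by
  simp [xListA, List.getD_eq_getElem?_getD, hi]

theorem listB_get (n i d : ℕ) (σ : Equiv.Perm (Fin n)) (hi : i < n) :
    (xListB n σ).getD i (d, true) =
      (((σ ⟨i, hi⟩ : Fin n) : ℕ), decide (((σ ⟨i, hi⟩ : Fin n) : ℕ) ≠ n - 1)) := by
  simp [xListB, List.getD_eq_getElem?_getD, hi]

theorem main (n : ℕ) (hn : 4 ≤ n) (σ : Equiv.Perm (Fin n)) :
    ∃ L : List (Clause ℕ), IsERRefutation (rPar n σ) L ∧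
      L.length ≤ 16 * n + 5 + (60 * Nat.clog 2 n * n + 28 * n + 3) := by
  have lenA : (xListA n).length = n := by simp [xListA]
  have lenB : (xListB n σ).length = n := by simp [xListB]
  have hA0 : ∀ C ∈ ParityCNF (xListA n) (fun k => n + k), C ∈ (rPar n σ).toList := by
    intro C hC
    rw [Finset.mem_toList]
    exact Finset.mem_union_left _ hC
  have hB0 : ∀ C ∈ ParityCNF (xListB n σ) (fun k => 2 * n + k), C ∈ (rPar n σ).toList := by
    intro C hC
    rw [Finset.mem_toList]
    exact Finset.mem_union_right _ hC
  have hcard : (rPar n σ).toList.length ≤ 16 * n := by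
    rw [Finset.length_toList]
    refine (Finset.card_union_le _ _).trans ?_
    have h1 := card_parity (xListA n) (fun k => n + k)
    have h2 := card_parity (xListB n σ) (fun k => 2 * n + k)
    rw [lenA] at h1
    rw [lenB] at h2
    omega
  have occ0 := parity_occ (by omega) hB0
  obtain ⟨L1, z, s1, hz⟩ := mk_zero (good_init (rPar n σ)) (occ0 0 (by omega))
  have cA := parity_chain hz n lenA hn (fun C hC => s1.2.1 (hA0 C hC))
  have cB := parity_chain hz n lenB hn (fun C hC => s1.2.1 (hB0 C hC))
  set lB := (List.range n).map (fun i => ((xListB n σ).getD i (2 * n + 0, true)).1) with hlB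
  have eA : (List.range n).map (fun i => ((xListA n).getD i (n + 0, true)).1) = List.range n := by
    conv_rhs => rw [← List.map_id (List.range n)]
    apply List.map_congr_left
    intro i hi
    rw [listA_get _ _ _ (List.mem_range.1 hi)]
    rfl
  have xA : X (fun i => !((xListA n).getD i (n + 0, true)).2) n = false := by
    apply foldr_false
    intro i hi
    rw [listA_get _ _ _ (List.mem_range.1 hi)]
    rfl
  have pB : lB.Perm (List.range n) := by
    have h1 : lB = List.ofFn (fun i : Fin n => ((σ i : Fin n) : ℕ)) := by
      apply List.ext_getElem
      · simp [lB]
      · intro i h1 h2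
        have hi : i < n := by simpa using h2
        simp only [lB, List.getElem_map, List.getElem_range, List.getElem_ofFn]
        rw [listB_get n i _ σ hi]
    have h2 : List.range n = List.ofFn (fun i : Fin n => (i : ℕ)) := by
      apply List.ext_getElem <;> simp
    rw [h1, h2]
    exact Equiv.Perm.ofFn_comp_perm σ (fun i : Fin n => (i : ℕ))
  have xB : X (fun i => !((xListB n σ).getD i (2 * n + 0, true)).2) n = true := by
    have h1 : (List.range n).map (fun i => !((xListB n σ).getD i (2 * n + 0, true)).2) =
        lB.map (fun v => decide (v = n - 1)) := by
      rw [hlB, List.map_map]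
      apply List.map_congr_left
      intro i hi
      simp only [Function.comp, listB_get _ _ _ σ (List.mem_range.1 hi)]
      simp
    have hp := (pB.map (fun v => decide (v = n - 1)))
    have : LeftCommutative xor := ⟨by decide⟩
    unfold X
    rw [h1, hp.foldr_eq]
    obtain ⟨m, rfl⟩ : ∃ m, n = m + 1 := ⟨n - 1, by omega⟩
    rw [List.range_succ, List.map_append, List.foldr_append]
    rw [foldr_false]
    · simp
    · intro x hx
      have := List.mem_range.1 hx
      simp
      omega
  rw [eA, xA] at cA
  rw [xB] at cB
  have lenlB : lB.length = n := by simp [lB]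
  obtain ⟨L2, s2, hE⟩ := refute (Nat.clog 2 n) lB (List.range n)
    (by rw [lenlB]; exact Nat.le_pow_clog (by norm_num) n) pB.symm
    (List.pairwise_lt_range.imp (fun h => le_of_lt h)) s1.1 hz
    (by
      intro w hw
      rw [hlB, List.mem_map] at hw
      obtain ⟨i, hi, rfl⟩ := hw
      exact (occ0 i (by rw [lenB]; exact List.mem_range.1 hi)).mono s1.2.1)
    cA cB
  rw [lenlB] at s2
  obtain ⟨i, hi, hget⟩ := List.getElem_of_mem hE
  have h12 := (s1.trans s2).2.2
  refine ⟨L2.take (i + 1), ⟨deriv_take s2.1 _, ?_⟩, ?_⟩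
  · rw [List.getLast?_eq_getElem?]
    simp only [List.length_take]
    rw [show min (i + 1) L2.length - 1 = i by omega, List.getElem?_take]
    simp [hi, hget]
  · rw [List.length_take]
    omega

end RPar

theorem rPar_short_er_refutation :
    ∃ K : ℝ, ∀ n : ℕ, 4 ≤ n → ∀ σ : Equiv.Perm (Fin n),
      ∃ L : List (Clause ℕ),
        IsERRefutation (rPar n σ) L ∧
        (L.length : ℝ) ≤ K * n * Real.log n := by
  refine ⟨318, fun n hn σ => ?_⟩
  obtain ⟨L, hL, hlen⟩ := RPar.main n hn σ
  refine ⟨L, hL, ?_⟩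
  have hk : 1 ≤ Nat.clog 2 n := Nat.clog_pos (by norm_num) (by omega)
  have h1 : L.length ≤ 106 * n * Nat.clog 2 n := by nlinarith
  have h2 : (L.length : ℝ) ≤ 106 * n * (Nat.clog 2 n : ℝ) := by exact_mod_cast h1
  have h3 := RPar.clog_bound n hn
  have h4 : (0 : ℝ) ≤ 106 * n := by positivity
  nlinarith [mul_le_mul_of_nonneg_left h3 h4]
end

section
/- There is a constant K such that the following holds: for every CNF formula F and literals x, y, z, q and variable p with p occurring in no clause of F, starting from F ∧ xor(x,y,p) ∧ xor(p,z,q) and introducing one fresh variable p′, one can derive all clauses of xor(y,z,p′) and xor(p′,x,q) in at most K extended resolution steps. -/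
variable {ν : Type} [DecidableEq ν]

namespace ERSwitch

/-! ### Abstract clauses as bit masks; literal code `2 * v + b`

The abstract variables are `0, …, 5`, with `0` standing for `p` and `5` for `p'`.
All possible coincidences among the variables of `x, y, z, q, p` are checked by evaluation of a
few candidate derivation trees on bit masks. -/

/-- Force evaluation of a number before passing it on (helps kernel reduction). -/
noncomputable def force {α : Type} (n : ℕ) (k : ℕ → α) : α :=
  Nat.rec (motive := fun _ => α) (k 0) (fun m _ => k (Nat.succ m)) n

theorem force_eq {α : Type} (n : ℕ) (k : ℕ → α) : force n k = k n := by
  cases n <;> rfl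

/-- Mask resolvent, `bl` and `bm` being the masks of the two clashing literals. -/
def res (bl bm c d : ℕ) : ℕ := Nat.lor (Nat.xor c bl) (Nat.xor d bm)

/-- The mask `m` contains the literal with mask `b`. -/
def has (b m : ℕ) : Bool := cond (Nat.beq (Nat.land m b) 0) false true

/-- Code of the negated literal. -/
def neg (a : ℕ) : ℕ := Nat.xor a 1

/-- Mask of the clause with three given literals. -/
def cl (a b c : ℕ) : ℕ :=
  Nat.lor (Nat.shiftLeft 1 a) (Nat.lor (Nat.shiftLeft 1 b) (Nat.shiftLeft 1 c))

def fl (a : ℕ) (s : Bool) : ℕ := cond s (neg a) a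

/-- Clause of `xor(a, b, c)` with given signs of `a` and `b`. -/
def k3 (a b c : ℕ) (s t : Bool) : ℕ := cl (fl a s) (fl b t) (fl c (!(xor s t)))

/-- Resolution of `c` and `d` on literal `l` if possible, otherwise one of `c`, `d`. -/
noncomputable def soft (l c d : ℕ) : ℕ :=
  force c fun c => force d fun d =>
  force (Nat.shiftLeft 1 l) fun bl => force (Nat.shiftLeft 1 (neg l)) fun bm =>
  cond (has bl c) (cond (has bm d) (res bl bm c d) d) c

/-- Names of formal literals (`nw` is the new variable). -/
inductive Nm
  | nx | ny | nz | nq | np | nw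

/-- Candidate derivation trees. -/
inductive Tr
  | a0 (s t : Bool)
  | a1 (s t : Bool)
  | a2 (s t : Bool)
  | r (v : Nm) (s : Bool) (P Q : Tr)

def Tr.depth : Tr → ℕ
  | .a0 _ _ => 0
  | .a1 _ _ => 0
  | .a2 _ _ => 0
  | .r _ _ P Q => max P.depth Q.depth + 1

def pick (x y z q p w : ℕ) : Nm → ℕ
  | .nx => x
  | .ny => y
  | .nz => z
  | .nq => q
  | .np => p
  | .nw => w

noncomputable def eval (x y z q p w : ℕ) : Tr → ℕ
  | .a0 s t => k3 x y p s t
  | .a1 s t => k3 p z q s t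
  | .a2 s t => k3 y z w s t
  | .r v s P Q => soft (fl (pick x y z q p w v) s) (eval x y z q p w P) (eval x y z q p w Q)

def trees : List Tr :=
  [.r .np false (.r .nz false (.r .ny true (.a0 false true) (.a2 false false)) (.a1 false true)) (.r .nz true (.r .ny false (.a0 false false) (.a2 true true)) (.a1 true false)),
   .r .np false (.r .ny false (.r .nz true (.a1 false true) (.a2 false false)) (.a0 false true)) (.r .ny true (.r .nz false (.a1 true false) (.a2 true true)) (.a0 false false)),
   .r .nz false (.r .ny false (.a2 false false) (.r .np false (.a0 false true) (.a1 true false))) (.r .ny true (.a2 true true) (.r .np true (.a0 false false) (.a1 false true))),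
   .r .ny true (.a2 true true) (.a0 false false),
   .r .ny false (.a2 false false) (.a0 false true),
   .r .nz true (.a0 false true) (.r .nw false (.r .ny true (.a2 true false) (.a2 false false)) (.r .np false (.a2 true true) (.a1 true false))),
   .r .np true (.r .ny true (.a2 true true) (.a1 true false)) (.a0 false true),
   .r .np false (.r .nz false (.a2 false false) (.a1 false true)) (.a0 false false),
   .r .nz true (.a2 true true) (.a1 true false),
   .r .np false (.r .ny false (.a2 false false) (.a0 true true)) (.a0 false false),
   .r .nw false (.r .np false (.a2 true true) (.a2 false true)) (.r .nz true (.a1 false true) (.a2 false false)),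
   .r .ny false (.a1 false true) (.r .nq true (.a2 false false) (.a2 true true)),
   .r .np false (.r .nq true (.a2 true true) (.a2 false false)) (.a1 true false),
   .r .nx true (.r .np false (.a0 true false) (.a0 false false)) (.r .ny false (.a2 false false) (.a0 false true)),
   .r .ny false (.r .nq false (.a2 false false) (.a0 true true)) (.a0 false true)]

noncomputable def tryAll (x y z q p w t : ℕ) : List Tr → Bool
  | [] => false
  | T :: l => cond (Nat.beq (eval x y z q p w T) t) true (tryAll x y z q p w t l)

/-- Check derivability of the clause of `xor(w, x, q)` with sign `b` of `x` and `c` of `q`. -/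
noncomputable def checkT (x y z q : ℕ) (b c : Bool) : Bool :=
  force (fl x b) fun x => force (fl z (xor b c)) fun z => force (fl q c) fun q =>
  force (fl 1 b) fun p => force (fl 11 (xor b c)) fun w =>
  force (cl (neg w) x q) fun t => tryAll x y z q p w t trees

def bools (f : Bool → Bool) : Bool := cond (f true) (f false) false

def code (v : ℕ) (b : Bool) : ℕ := Nat.add (Nat.mul 2 v) (cond b 1 0)

noncomputable def checkS (ix iy iz iq : ℕ) : Bool :=
  bools fun bx => bools fun b_y => bools fun bz => bools fun bq =>
  force (code ix bx) fun x => force (code iy b_y) fun y => force (code iz bz) fun z =>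
  force (code iq bq) fun q =>
  bools fun b => bools fun c => checkT x y z q b c

def upTo (f : ℕ → Bool) : ℕ → Bool
  | 0 => f 0
  | n + 1 => cond (f (n + 1)) (upTo f n) false

noncomputable def checkAll : Bool :=
  upTo (fun ix => upTo (fun iy => upTo (fun iz => upTo (fun iq =>
    force ix fun ix => force iy fun iy => force iz fun iz => force iq fun iq =>
    checkS ix iy iz iq)
    (max (max (max 1 (ix + 1)) (iy + 1)) (iz + 1)))
    (max (max 1 (ix + 1)) (iy + 1))) (max 1 (ix + 1))) 1

set_option maxHeartbeats 4000000 in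
theorem checkAll_true : checkAll = true := by decide +kernel

/-! ### Soundness of the evaluation -/

/-- Literal with a given code. -/
def lit (e : ℕ → ℕ) (a : ℕ) : Lit ℕ := (e (a / 2), decide (a % 2 = 1))

/-- Clause with a given mask. -/
def itp (e : ℕ → ℕ) (m : ℕ) : Clause ℕ :=
  ((Finset.range m).filter fun a => m.testBit a = true).image (lit e)

theorem mem_itp (e : ℕ → ℕ) (m : ℕ) (l : Lit ℕ) :
    l ∈ itp e m ↔ ∃ a, m.testBit a = true ∧ lit e a = l := by
  simp only [itp, Finset.mem_image, Finset.mem_filter, Finset.mem_range]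
  constructor
  · rintro ⟨a, ⟨_, h⟩, h2⟩
    exact ⟨a, h, h2⟩
  · rintro ⟨a, h, h2⟩
    exact ⟨a, ⟨lt_of_lt_of_le Nat.lt_two_pow_self (Nat.ge_two_pow_of_testBit h), h⟩, h2⟩

theorem lit_inj {e : ℕ → ℕ} (he : Function.Injective e) : Function.Injective (lit e) := by
  intro a b h
  simp only [lit, Prod.mk.injEq] at h
  have h1 := he h.1
  have h2 := h.2
  rw [decide_eq_decide] at h2
  omega

theorem neg_def (a : ℕ) : neg a = a ^^^ 1 := rfl

theorem neg_even (v : ℕ) : neg (2 * v) = 2 * v + 1 := by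
  rw [neg_def]; apply Nat.eq_of_testBit_eq; intro i; cases i <;> simp [Nat.testBit_succ]

theorem neg_neg' (a : ℕ) : neg (neg a) = a := by
  rw [neg_def, neg_def, Nat.xor_assoc]; simp

theorem neg_odd (v : ℕ) : neg (2 * v + 1) = 2 * v := by
  rw [← neg_even, neg_neg']

theorem lit_neg (e : ℕ → ℕ) (a : ℕ) : lit e (neg a) = negLit (lit e a) := by
  rcases Nat.even_or_odd' a with ⟨v, rfl | rfl⟩
  · have : (2 * v + 1) / 2 = v := by omega
    rw [neg_even]; simp [lit, negLit, this]
  · have : (2 * v + 1) / 2 = v := by omega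
    rw [neg_odd]; simp [lit, negLit, this]

theorem itp_cl (e : ℕ → ℕ) (a b c : ℕ) : itp e (cl a b c) = {lit e a, lit e b, lit e c} := by
  ext l
  rw [mem_itp]
  have : ∀ i, (cl a b c).testBit i = (decide (a = i) || (decide (b = i) || decide (c = i))) := by
    intro i
    change ((1 <<< a) ||| ((1 <<< b) ||| (1 <<< c))).testBit i = _
    simp [Nat.testBit_or, Nat.one_shiftLeft, Nat.testBit_two_pow]
  simp only [this, Finset.mem_insert, Finset.mem_singleton, Bool.or_eq_true, decide_eq_true_eq]
  constructor
  · rintro ⟨i, h | h | h, rfl⟩ <;> subst h <;> simp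
  · rintro (h | h | h) <;> subst h
    exacts [⟨a, by simp⟩, ⟨b, by simp⟩, ⟨c, by simp⟩]

theorem has_iff (a m : ℕ) : has (Nat.shiftLeft 1 a) m = true ↔ m.testBit a = true := by
  change cond (Nat.beq (m &&& (1 <<< a)) 0) false true = true ↔ _
  rw [Nat.one_shiftLeft, Nat.and_two_pow]
  cases h : m.testBit a
  · simp
  · have : Nat.beq (2 ^ a) 0 = false := by
      cases hb : Nat.beq (2 ^ a) 0
      · rfl
      · have h1 := Nat.eq_of_beq_eq_true hb
        have h2 : 0 < 2 ^ a := by positivity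
        omega
    simp [this]

theorem testBit_res (l m c d i : ℕ) :
    (res (Nat.shiftLeft 1 l) (Nat.shiftLeft 1 m) c d).testBit i =
      ((c.testBit i ^^ decide (l = i)) || (d.testBit i ^^ decide (m = i))) := by
  change ((c ^^^ (1 <<< l)) ||| (d ^^^ (1 <<< m))).testBit i = _
  simp [Nat.testBit_or, Nat.testBit_xor, Nat.one_shiftLeft, Nat.testBit_two_pow]

theorem itp_res {e : ℕ → ℕ} (he : Function.Injective e) {l m c d : ℕ}
    (hc : c.testBit l = true) (hd : d.testBit m = true) :
    itp e (res (Nat.shiftLeft 1 l) (Nat.shiftLeft 1 m) c d) =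
      (itp e c).erase (lit e l) ∪ (itp e d).erase (lit e m) := by
  ext k
  simp only [mem_itp, Finset.mem_union, Finset.mem_erase, testBit_res]
  constructor
  · rintro ⟨i, h, rfl⟩
    simp only [Bool.or_eq_true] at h
    rcases h with h | h
    · left
      by_cases hi : l = i
      · subst hi; simp [hc] at h
      · exact ⟨fun h' => hi (lit_inj he h').symm, i, by simpa [hi] using h, rfl⟩
    · right
      by_cases hi : m = i
      · subst hi; simp [hd] at h
      · exact ⟨fun h' => hi (lit_inj he h').symm, i, by simpa [hi] using h, rfl⟩
  · rintro (⟨h, i, hi, rfl⟩ | ⟨h, i, hi, rfl⟩)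
    · have : l ≠ i := fun h' => h (by rw [h'])
      exact ⟨i, by simp [hi, this], rfl⟩
    · have : m ≠ i := fun h' => h (by rw [h'])
      exact ⟨i, by simp [hi, this], rfl⟩

/-- Derivability by resolution, in bounded depth. -/
def Der (A : Clause ℕ → Prop) : ℕ → Clause ℕ → Prop
  | 0, C => A C
  | n + 1, C => Der A n C ∨ ∃ C1 C2, Der A n C1 ∧ Der A n C2 ∧ IsResolvent C1 C2 C

theorem Der.mono {A : Clause ℕ → Prop} {C : Clause ℕ} {m n : ℕ} (h : m ≤ n) (hC : Der A m C) :
    Der A n C := by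
  induction h with
  | refl => exact hC
  | step _ ih => exact Or.inl ih

theorem isResolvent_itp {e : ℕ → ℕ} (he : Function.Injective e) {l c d : ℕ}
    (hc : c.testBit l = true) (hd : d.testBit (neg l) = true) :
    IsResolvent (itp e c) (itp e d)
        (itp e (res (Nat.shiftLeft 1 l) (Nat.shiftLeft 1 (neg l)) c d)) ∨
      IsResolvent (itp e d) (itp e c)
        (itp e (res (Nat.shiftLeft 1 l) (Nat.shiftLeft 1 (neg l)) c d)) := by
  rw [itp_res he hc hd]
  have h1 : lit e l ∈ itp e c := (mem_itp _ _ _).2 ⟨l, hc, rfl⟩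
  have h2 : lit e (neg l) ∈ itp e d := (mem_itp _ _ _).2 ⟨_, hd, rfl⟩
  rw [lit_neg] at h2 ⊢
  generalize lit e l = k at *
  obtain ⟨v, b⟩ := k
  cases b
  · right
    exact ⟨v, h2, h1, Finset.union_comm _ _⟩
  · left
    exact ⟨v, h1, h2, rfl⟩

theorem der_soft {e : ℕ → ℕ} (he : Function.Injective e) {A : Clause ℕ → Prop} {n l c d : ℕ}
    (hc : Der A n (itp e c)) (hd : Der A n (itp e d)) : Der A (n + 1) (itp e (soft l c d)) := by
  simp only [soft, force_eq]
  cases h1 : has (Nat.shiftLeft 1 l) c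
  · exact Or.inl hc
  · cases h2 : has (Nat.shiftLeft 1 (neg l)) d
    · exact Or.inl hd
    · rw [has_iff] at h1 h2
      rcases isResolvent_itp he h1 h2 with h | h
      · exact Or.inr ⟨_, _, hc, hd, h⟩
      · exact Or.inr ⟨_, _, hd, hc, h⟩

theorem der_eval {e : ℕ → ℕ} (he : Function.Injective e) {A : Clause ℕ → Prop}
    {x y z q p w : ℕ} (h0 : ∀ s t, A (itp e (k3 x y p s t))) (h1 : ∀ s t, A (itp e (k3 p z q s t)))
    (h2 : ∀ s t, A (itp e (k3 y z w s t))) (T : Tr) :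
    Der A T.depth (itp e (eval x y z q p w T)) := by
  induction T with
  | a0 s t => exact h0 s t
  | a1 s t => exact h1 s t
  | a2 s t => exact h2 s t
  | r v s P Q ihP ihQ =>
    exact der_soft he (ihP.mono (le_max_left _ _)) (ihQ.mono (le_max_right _ _))

theorem tryAll_sound {x y z q p w t : ℕ} {l : List Tr} (h : tryAll x y z q p w t l = true) :
    ∃ T ∈ l, eval x y z q p w T = t := by
  induction l with
  | nil => simp [tryAll] at h
  | cons T l ih =>
    rw [tryAll] at h
    cases hb : Nat.beq (eval x y z q p w T) t
    · rw [hb] at h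
      obtain ⟨T', h1, h2⟩ := ih h
      exact ⟨T', List.mem_cons_of_mem _ h1, h2⟩
    · exact ⟨T, List.mem_cons_self, Nat.eq_of_beq_eq_true hb⟩

theorem trees_depth : ∀ T ∈ trees, T.depth ≤ 3 := by
  simp [trees, Tr.depth]

theorem fl_fl (a : ℕ) (s t : Bool) : fl (fl a s) t = fl a (xor s t) := by
  cases s <;> cases t <;> simp [fl, neg_neg']

theorem checkT_sound {e : ℕ → ℕ} (he : Function.Injective e) {A : Clause ℕ → Prop}
    {x y z q : ℕ} (h0 : ∀ s t, A (itp e (k3 x y 1 s t))) (h1 : ∀ s t, A (itp e (k3 1 z q s t)))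
    (h2 : ∀ s t, A (itp e (k3 y z 11 s t))) {b c : Bool} (h : checkT x y z q b c = true) :
    Der A 3 (itp e (cl (fl 11 (!(xor b c))) (fl x b) (fl q c))) := by
  simp only [checkT, force_eq] at h
  obtain ⟨T, hT, hE⟩ := tryAll_sound h
  have hn : neg (fl 11 (xor b c)) = fl 11 (!(xor b c)) := by
    cases b <;> cases c <;> simp [fl, neg_neg']
  rw [hn] at hE
  rw [← hE]
  refine Der.mono (trees_depth T hT) (der_eval he ?_ ?_ ?_ T)
  · intro s t
    have := h0 (xor b s) t
    convert this using 2
    cases b <;> cases s <;> cases t <;> simp [k3, fl, neg_neg']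
  · intro s t
    have := h1 (xor b s) (xor (xor b c) t)
    convert this using 2
    cases b <;> cases c <;> cases s <;> cases t <;> simp [k3, fl, neg_neg']
  · intro s t
    have := h2 s (xor (xor b c) t)
    convert this using 2
    cases b <;> cases c <;> cases s <;> cases t <;> simp [k3, fl, neg_neg']

theorem bools_sound {f : Bool → Bool} (h : bools f = true) (b : Bool) : f b = true := by
  simp only [bools] at h
  cases h1 : f true
  · simp [h1] at h
  · rw [h1] at h
    cases b
    · exact h
    · exact h1

theorem upTo_sound {f : ℕ → Bool} {n : ℕ} (h : upTo f n = true) {i : ℕ} (hi : i ≤ n) :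
    f i = true := by
  induction n with
  | zero => rw [Nat.le_zero.1 hi]; exact h
  | succ n ih =>
    rw [upTo] at h
    cases h1 : f (n + 1)
    · simp [h1] at h
    · rw [h1] at h
      rcases Nat.le_succ_iff.1 hi with h' | h'
      · exact ih h h'
      · rw [h']; exact h1

theorem check_sound {ix iy iz iq : ℕ} (hx : ix ≤ 1) (hy : iy ≤ max 1 (ix + 1))
    (hz : iz ≤ max (max 1 (ix + 1)) (iy + 1))
    (hq : iq ≤ max (max (max 1 (ix + 1)) (iy + 1)) (iz + 1)) (bx b_y bz bq b c : Bool) :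
    checkT (code ix bx) (code iy b_y) (code iz bz) (code iq bq) b c = true := by
  have h := upTo_sound (upTo_sound (upTo_sound (upTo_sound checkAll_true hx) hy) hz) hq
  simp only [force_eq, checkS] at h
  exact bools_sound (bools_sound (bools_sound (bools_sound (bools_sound
    (bools_sound h bx) b_y) bz) bq) b) c

/-! ### Naming the variables -/

theorem name_step (e : Equiv.Perm ℕ) (k j x : ℕ) (hj : k ≤ j) (hx : ∀ i < k, e i ≠ x) :
    ∃ e' : Equiv.Perm ℕ, e' j = x ∧ ∀ i < k, e' i = e i := by
  refine ⟨e.trans (Equiv.swap (e j) x), by simp, fun i hi => ?_⟩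
  simp only [Equiv.trans_apply]
  refine Equiv.swap_apply_of_ne_of_ne (fun h => ?_) (hx i hi)
  have := e.injective h
  omega

theorem name_step' (e : Equiv.Perm ℕ) (k x : ℕ) :
    ∃ i ≤ k, ∃ e' : Equiv.Perm ℕ, e' i = x ∧ ∀ i < k, e' i = e i := by
  by_cases h : ∃ i < k, e i = x
  · obtain ⟨i, hi, h⟩ := h
    exact ⟨i, hi.le, e, h, fun _ _ => rfl⟩
  · push Not at h
    obtain ⟨e', h1, h2⟩ := name_step e k k x le_rfl h
    exact ⟨k, le_rfl, e', h1, h2⟩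

theorem exists_names (p x y z q w : ℕ) (hp : p ≠ w) (hx : x ≠ w) (hy : y ≠ w) (hz : z ≠ w)
    (hq : q ≠ w) : ∃ (e : Equiv.Perm ℕ) (ix iy iz iq : ℕ),
      ix ≤ 1 ∧ iy ≤ max 1 (ix + 1) ∧ iz ≤ max (max 1 (ix + 1)) (iy + 1) ∧
      iq ≤ max (max (max 1 (ix + 1)) (iy + 1)) (iz + 1) ∧
      e 0 = p ∧ e ix = x ∧ e iy = y ∧ e iz = z ∧ e iq = q ∧ e 5 = w := by
  obtain ⟨e0, h0, -⟩ := name_step (Equiv.refl ℕ) 0 0 p le_rfl (by simp)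
  obtain ⟨ix, hix, e1, h1, g1⟩ := name_step' e0 1 x
  obtain ⟨iy, hiy, e2, h2, g2⟩ := name_step' e1 (max 1 (ix + 1)) y
  obtain ⟨iz, hiz, e3, h3, g3⟩ := name_step' e2 (max (max 1 (ix + 1)) (iy + 1)) z
  obtain ⟨iq, hiq, e4, h4, g4⟩ := name_step' e3 (max (max (max 1 (ix + 1)) (iy + 1)) (iz + 1)) q
  have p1 : e1 0 = p := by rw [g1 0 (by omega), h0]
  have p2 : e2 0 = p := by rw [g2 0 (by omega), p1]
  have p3 : e3 0 = p := by rw [g3 0 (by omega), p2]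
  have p4 : e4 0 = p := by rw [g4 0 (by omega), p3]
  have x2 : e2 ix = x := by rw [g2 ix (by omega), h1]
  have x3 : e3 ix = x := by rw [g3 ix (by omega), x2]
  have x4 : e4 ix = x := by rw [g4 ix (by omega), x3]
  have y3 : e3 iy = y := by rw [g3 iy (by omega), h2]
  have y4 : e4 iy = y := by rw [g4 iy (by omega), y3]
  have z4 : e4 iz = z := by rw [g4 iz (by omega), h3]
  refine ⟨e4.trans (Equiv.swap (e4 5) w), ix, iy, iz, iq, hix, hiy, hiz, hiq, ?_, ?_, ?_, ?_, ?_,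
    by simp⟩
  all_goals
    simp only [Equiv.trans_apply]
    rw [Equiv.swap_apply_of_ne_of_ne]
    · assumption
    · intro h
      have := e4.injective h
      omega
    · simp only [*]
      assumption

/-! ### Clauses of the parity constraints -/

theorem mem_xorCNF (a b c : Lit ℕ) (C : Clause ℕ) : C ∈ xorCNF [a, b, c] ↔
    ∃ s t : Bool, C = {cond s (negLit a) a, cond t (negLit b) b,
      cond (!(xor s t)) (negLit c) c} := by
  have key : ∀ f : Fin 3 → Bool,
      (Finset.univ.filter (fun i => f i = true)).card % 2 = 1 ↔ f 2 = !(xor (f 0) (f 1)) := by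
    decide
  have img : ∀ f : Fin 3 → Bool,
      (Finset.univ.image (fun i : Fin 3 => if f i then negLit ([a, b, c].get i) else [a, b, c].get i)
        : Clause ℕ) = {cond (f 0) (negLit a) a, cond (f 1) (negLit b) b,
          cond (f 2) (negLit c) c} := by
    intro f
    have hu : (Finset.univ : Finset (Fin 3)) = {0, 1, 2} := by decide
    rw [hu, Finset.image_insert, Finset.image_insert, Finset.image_singleton]
    cases f 0 <;> cases f 1 <;> cases f 2 <;> rfl
  simp only [xorCNF, parityCNF, Finset.mem_image, Finset.mem_filter, Finset.mem_univ, true_and]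
  constructor
  · rintro ⟨f, hf, rfl⟩
    refine ⟨f 0, f 1, ?_⟩
    rw [← (key f).1 hf]
    exact img f
  · rintro ⟨s, t, rfl⟩
    refine ⟨![s, t, !(xor s t)], (key _).2 rfl, ?_⟩
    exact img _

theorem itp_k3 (e : ℕ → ℕ) (a b c : ℕ) (s t : Bool) : itp e (k3 a b c s t) =
    {cond s (negLit (lit e a)) (lit e a), cond t (negLit (lit e b)) (lit e b),
      cond (!(xor s t)) (negLit (lit e c)) (lit e c)} := by
  rw [k3, itp_cl]
  cases s <;> cases t <;> simp [fl, lit_neg]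

theorem lit_code (e : ℕ → ℕ) (v : ℕ) (b : Bool) : lit e (code v b) = (e v, b) := by
  have h : code v b = 2 * v + cond b 1 0 := rfl
  rw [h]
  have : (2 * v + 1) / 2 = v := by omega
  cases b <;> simp [lit, this]

/-! ### Building derivations -/

theorem deriv_snoc {F : CNF ℕ} {M : List (Clause ℕ)} {C : Clause ℕ} (hM : IsERDeriv F M)
    (h : C ∈ F ∨ (∃ C1 ∈ M, ∃ C2 ∈ M, IsResolvent C1 C2 C) ∨
      ∃ (g : Bool → Bool → Bool) (v : ℕ) (l1 l2 : Lit ℕ),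
        v ∉ cnfVars F ∧ l1.1 ≠ v ∧ l2.1 ≠ v ∧ l1.1 ∈ cnfVars F ∧ l2.1 ∈ cnfVars F ∧
        (∀ D ∈ M, v ∈ clauseVars D → ∃ b1 b2, D = defClause g v l1 l2 b1 b2) ∧
        ∃ b1 b2, C = defClause g v l1 l2 b1 b2) :
    IsERDeriv F (M ++ [C]) := by
  intro i hi
  have old : ∀ j, (hj : j < M.length) → (hj' : j < (M ++ [C]).length) → (M ++ [C])[j] = M[j] :=
    fun j hj hj' => List.getElem_append_left hj
  rw [List.length_append, List.length_singleton] at hi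
  by_cases hiM : i < M.length
  · rcases hM i hiM with h1 | ⟨j, k, hj, hk, h1⟩ | ⟨g, v, l1, l2, h1, h2, h3, h4, h5, h6, h7⟩
    · left
      rwa [old i hiM]
    · right; left
      refine ⟨j, k, hj, hk, ?_⟩
      rwa [old i hiM, old j (hj.trans hiM), old k (hk.trans hiM)]
    · right; right
      refine ⟨g, v, l1, l2, h1, h2, h3, ?_, ?_, ?_, ?_⟩
      · refine h4.imp_right ?_
        rintro ⟨j, hj, h⟩
        refine ⟨j, hj, ?_⟩
        rwa [old j (hj.trans hiM)]
      · refine h5.imp_right ?_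
        rintro ⟨j, hj, h⟩
        refine ⟨j, hj, ?_⟩
        rwa [old j (hj.trans hiM)]
      · intro j hj
        rw [old j (hj.trans hiM)]
        exact h6 j hj
      · rwa [old i hiM]
  · have hi' : i = M.length := by omega
    subst hi'
    have hC : (M ++ [C])[M.length]'(by simp) = C := by simp
    rcases h with h1 | ⟨C1, hC1, C2, hC2, h1⟩ | ⟨g, v, l1, l2, h1, h2, h3, h4, h5, h6, h7⟩
    · left
      rwa [hC]
    · right; left
      obtain ⟨j, hj, rfl⟩ := List.getElem_of_mem hC1
      obtain ⟨k, hk, rfl⟩ := List.getElem_of_mem hC2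
      refine ⟨j, k, hj, hk, ?_⟩
      rwa [hC, old j hj, old k hk]
    · right; right
      refine ⟨g, v, l1, l2, h1, h2, h3, Or.inl h4, Or.inl h5, ?_, ?_⟩
      · intro j hj
        rw [old j hj]
        exact h6 _ (List.getElem_mem hj)
      · rwa [hC]

theorem deriv_start {F : CNF ℕ} (M N : List (Clause ℕ)) (hM : IsERDeriv F M)
    (hN : ∀ C ∈ N, C ∈ F) : IsERDeriv F (M ++ N) := by
  induction N generalizing M with
  | nil => simpa using hM
  | cons C N ih =>
    have := ih (M ++ [C]) (deriv_snoc hM (Or.inl (hN C (by simp))))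
      (fun D hD => hN D (by simp [hD]))
    simpa using this

theorem deriv_defs {F : CNF ℕ} {g : Bool → Bool → Bool} {v : ℕ} {l1 l2 : Lit ℕ}
    (h1 : v ∉ cnfVars F) (h4 : l1.1 ∈ cnfVars F) (h5 : l2.1 ∈ cnfVars F)
    (M N : List (Clause ℕ)) (hM : IsERDeriv F M)
    (h6 : ∀ D ∈ M, v ∈ clauseVars D → ∃ b1 b2, D = defClause g v l1 l2 b1 b2)
    (hN : ∀ C ∈ N, ∃ b1 b2, C = defClause g v l1 l2 b1 b2) : IsERDeriv F (M ++ N) := by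
  induction N generalizing M with
  | nil => simpa using hM
  | cons C N ih =>
    have := ih (M ++ [C]) (deriv_snoc hM (Or.inr (Or.inr ⟨g, v, l1, l2, h1,
      fun h => h1 (h ▸ h4), fun h => h1 (h ▸ h5), h4, h5, h6, hN C (by simp)⟩))) ?_
      (fun D hD => hN D (by simp [hD]))
    · simpa using this
    · intro D hD hv
      rw [List.mem_append, List.mem_singleton] at hD
      rcases hD with hD | rfl
      · exact h6 D hD hv
      · exact hN D (by simp)

theorem deriv_der {F : CNF ℕ} {A : Clause ℕ → Prop} {V : Set ℕ} {n : ℕ} {C : Clause ℕ}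
    (hC : Der A n C) (M : List (Clause ℕ)) (hM : IsERDeriv F M) (hA : ∀ D, A D → D ∈ M)
    (hV : ∀ D ∈ M, clauseVars D ⊆ V) :
    ∃ N, IsERDeriv F (M ++ N) ∧ C ∈ M ++ N ∧ N.length + 1 ≤ 2 ^ n ∧
      ∀ D ∈ M ++ N, clauseVars D ⊆ V := by
  induction n generalizing C M with
  | zero => exact ⟨[], by simpa using hM, by simpa using hA C hC, by simp, by simpa using hV⟩
  | succ n ih =>
    rcases hC with hC | ⟨C1, C2, h1, h2, hR⟩
    · obtain ⟨N, a, b, c, d⟩ := ih hC M hM hA hV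
      exact ⟨N, a, b, by rw [pow_succ]; omega, d⟩
    · obtain ⟨N1, a1, b1, c1, d1⟩ := ih h1 M hM hA hV
      obtain ⟨N2, a2, b2, c2, d2⟩ := ih h2 (M ++ N1) a1
        (fun D hD => List.mem_append_left _ (hA D hD)) d1
      have b1' : C1 ∈ M ++ N1 ++ N2 := List.mem_append_left _ b1
      refine ⟨N1 ++ N2 ++ [C], ?_, by simp, ?_, ?_⟩
      · have := deriv_snoc a2 (Or.inr (Or.inl ⟨C1, b1', C2, b2, hR⟩))
        simpa using this
      · simp only [List.length_append, List.length_singleton]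
        rw [pow_succ]; omega
      · intro D hD
        have hD' : D ∈ M ++ N1 ++ N2 ∨ D = C := by
          simpa [or_assoc] using hD
        rcases hD' with hD' | rfl
        · exact d2 D hD'
        · obtain ⟨v, -, -, rfl⟩ := hR
          rintro u ⟨b, hb⟩
          rw [Finset.mem_union, Finset.mem_erase, Finset.mem_erase] at hb
          rcases hb with hb | hb
          · exact d2 _ b1' ⟨b, hb.2⟩
          · exact d2 _ b2 ⟨b, hb.2⟩

theorem deriv_ders {F : CNF ℕ} {A : Clause ℕ → Prop} {V : Set ℕ} {n : ℕ} (Ts : List (Clause ℕ))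
    (hC : ∀ C ∈ Ts, Der A n C) (M : List (Clause ℕ)) (hM : IsERDeriv F M)
    (hA : ∀ D, A D → D ∈ M) (hV : ∀ D ∈ M, clauseVars D ⊆ V) :
    ∃ N, IsERDeriv F (M ++ N) ∧ (∀ C ∈ Ts, C ∈ M ++ N) ∧ N.length ≤ Ts.length * 2 ^ n ∧
      ∀ D ∈ M ++ N, clauseVars D ⊆ V := by
  induction Ts generalizing M with
  | nil => exact ⟨[], by simpa using hM, by simp, by simp, by simpa using hV⟩
  | cons C Ts ih =>
    obtain ⟨N1, a1, b1, c1, d1⟩ := deriv_der (hC C (by simp)) M hM hA hV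
    obtain ⟨N2, a2, b2, c2, d2⟩ := ih (fun D hD => hC D (by simp [hD])) (M ++ N1) a1
      (fun D hD => List.mem_append_left _ (hA D hD)) d1
    rw [List.append_assoc] at a2 b2 d2
    refine ⟨N1 ++ N2, a2, ?_, ?_, d2⟩
    · intro D hD
      rcases List.mem_cons.1 hD with rfl | hD
      · rw [← List.append_assoc]; exact List.mem_append_left _ b1
      · exact b2 D hD
    · simp only [List.length_append, List.length_cons, Nat.add_mul]
      omega

/-- Explicit list of the clauses of `xor(a, b, c)`. -/
def xl (a b c : Lit ℕ) : List (Clause ℕ) :=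
  [(true, true), (true, false), (false, true), (false, false)].map fun st =>
    {cond st.1 (negLit a) a, cond st.2 (negLit b) b, cond (!(xor st.1 st.2)) (negLit c) c}

theorem mem_xl (a b c : Lit ℕ) (C : Clause ℕ) : C ∈ xl a b c ↔ C ∈ xorCNF [a, b, c] := by
  rw [mem_xorCNF]
  simp only [xl, List.mem_map]
  constructor
  · rintro ⟨st, -, rfl⟩
    exact ⟨st.1, st.2, rfl⟩
  · rintro ⟨s, t, rfl⟩
    exact ⟨(s, t), by cases s <;> cases t <;> simp, rfl⟩

theorem vars_xor {a b c : Lit ℕ} {C : Clause ℕ} (h : C ∈ xorCNF [a, b, c]) :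
    clauseVars C = {a.1, b.1, c.1} := by
  obtain ⟨s, t, rfl⟩ := (mem_xorCNF a b c C).1 h
  have hc : ∀ (s : Bool) (l : Lit ℕ), (cond s (negLit l) l).1 = l.1 := by
    intro s l; cases s <;> rfl
  ext v
  simp only [clauseVars, Set.mem_setOf_eq, Finset.mem_insert, Finset.mem_singleton,
    Set.mem_insert_iff, Set.mem_singleton_iff]
  constructor
  · rintro ⟨d, h | h | h⟩
    · left; rw [← hc s a, ← h]
    · right; left; rw [← hc t b, ← h]
    · right; right; rw [← hc (!(xor s t)) c, ← h]
  · rintro (h | h | h)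
    · exact ⟨(cond s (negLit a) a).2, Or.inl (by rw [h, ← hc s a])⟩
    · exact ⟨(cond t (negLit b) b).2, Or.inr (Or.inl (by rw [h, ← hc t b]))⟩
    · exact ⟨(cond (!(xor s t)) (negLit c) c).2, Or.inr (Or.inr (by rw [h, ← hc (!(xor s t)) c]))⟩

theorem cnfVars_finite (F : CNF ℕ) : (cnfVars F).Finite := by
  refine ((F.sup id).image Prod.fst).finite_toSet.subset ?_
  rintro v ⟨C, hC, b, hb⟩
  simp only [Finset.coe_image, Set.mem_image, Finset.mem_coe, Finset.mem_sup]
  exact ⟨(v, b), ⟨C, hC, hb⟩, rfl⟩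

theorem defs_xor {a b : Lit ℕ} {w : ℕ} {C : Clause ℕ} (h : C ∈ xorCNF [a, b, (w, true)]) :
    ∃ b1 b2, C = defClause xor w a b b1 b2 := by
  obtain ⟨s, t, rfl⟩ := (mem_xorCNF _ _ _ C).1 h
  refine ⟨s, t, ?_⟩
  obtain ⟨a, a'⟩ := a
  obtain ⟨b, b'⟩ := b
  cases s <;> cases t <;> simp [defClause, negLit]

theorem ders_target (x y z q : Lit ℕ) (p w : ℕ) (hp : p ≠ w) (hx : x.1 ≠ w) (hy : y.1 ≠ w)
    (hz : z.1 ≠ w) (hq : q.1 ≠ w) (C : Clause ℕ) (hC : C ∈ xorCNF [(w, true), x, q]) :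
    Der (fun D => D ∈ xorCNF [x, y, (p, true)] ∨ D ∈ xorCNF [(p, true), z, q] ∨
      D ∈ xorCNF [y, z, (w, true)]) 3 C := by
  obtain ⟨e, ix, iy, iz, iq, hix, hiy, hiz, hiq, h0, h1, h2, h3, h4, h5⟩ :=
    exists_names p x.1 y.1 z.1 q.1 w hp hx hy hz hq
  have lx : lit e (code ix x.2) = x := by rw [lit_code, h1]
  have ly : lit e (code iy y.2) = y := by rw [lit_code, h2]
  have lz : lit e (code iz z.2) = z := by rw [lit_code, h3]
  have lq : lit e (code iq q.2) = q := by rw [lit_code, h4]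
  have lp : lit e 1 = (p, true) := by simp [lit, h0]
  have lw : lit e 11 = (w, true) := by simp [lit, h5]
  obtain ⟨s, t, rfl⟩ := (mem_xorCNF _ _ _ C).1 hC
  have key := checkT_sound (e := e) e.injective
    (A := fun D => D ∈ xorCNF [x, y, (p, true)] ∨ D ∈ xorCNF [(p, true), z, q] ∨
      D ∈ xorCNF [y, z, (w, true)])
    (x := code ix x.2) (y := code iy y.2) (z := code iz z.2) (q := code iq q.2)
    (fun s t => Or.inl ((mem_xorCNF _ _ _ _).2 ⟨s, t, by rw [itp_k3, lx, ly, lp]⟩))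
    (fun s t => Or.inr (Or.inl ((mem_xorCNF _ _ _ _).2 ⟨s, t, by rw [itp_k3, lz, lq, lp]⟩)))
    (fun s t => Or.inr (Or.inr ((mem_xorCNF _ _ _ _).2 ⟨s, t, by rw [itp_k3, ly, lz, lw]⟩)))
    (check_sound hix hiy hiz hiq x.2 y.2 z.2 q.2 t (!(xor s t)))
  have hE : cl (fl 11 (!(xor t (!(xor s t))))) (fl (code ix x.2) t) (fl (code iq q.2) (!(xor s t)))
      = k3 11 (code ix x.2) (code iq q.2) s t := by
    cases s <;> cases t <;> rfl
  rw [hE, itp_k3, lx, lq, lw] at key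
  exact key

end ERSwitch

open ERSwitch in
/-- There is a constant `K` such that for every CNF `F`, literals
`x, y, z, q` and variable `p` occurring in no clause of `F`, starting from
`F ∧ xor(x,y,p) ∧ xor(p,z,q)` and introducing one fresh variable `p'`, one can derive
all clauses of `xor(y,z,p')` and `xor(p',x,q)` in at most `K` extended resolution
steps. -/
theorem er_switching :
    ∃ K : ℕ, ∀ (F : CNF ℕ) (x y z q : Lit ℕ) (p : ℕ), p ∉ cnfVars F →
      ∃ (p' : ℕ) (L : List (Clause ℕ)),
        p' ∉ cnfVars (F ∪ xorCNF [x, y, (p, true)] ∪ xorCNF [(p, true), z, q]) ∧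
        IsERDeriv (F ∪ xorCNF [x, y, (p, true)] ∪ xorCNF [(p, true), z, q]) L ∧
        (∀ v : ℕ, (∃ C ∈ L, v ∈ clauseVars C) →
          v ∈ cnfVars (F ∪ xorCNF [x, y, (p, true)] ∪ xorCNF [(p, true), z, q]) ∨ v = p') ∧
        (∀ C ∈ xorCNF [y, z, (p', true)] ∪ xorCNF [(p', true), x, q], C ∈ L) ∧
        L.length ≤ K := by
  refine ⟨44, fun F x y z q p _ => ?_⟩
  obtain ⟨w, hw⟩ := (cnfVars_finite
    (F ∪ xorCNF [x, y, (p, true)] ∪ xorCNF [(p, true), z, q])).exists_notMem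
  generalize hG : F ∪ xorCNF [x, y, (p, true)] ∪ xorCNF [(p, true), z, q] = G at *
  have s1 : ∀ C ∈ xorCNF [x, y, (p, true)], C ∈ G := fun C hC => by simp [← hG, hC]
  have s2 : ∀ C ∈ xorCNF [(p, true), z, q], C ∈ G := fun C hC => by simp [← hG, hC]
  have sub : ∀ C ∈ G, clauseVars C ⊆ cnfVars G := fun C hC v ⟨b, hb⟩ => ⟨C, hC, b, hb⟩
  have v1 : ({x.1, y.1, p} : Set ℕ) ⊆ cnfVars G := by
    obtain ⟨C, hC⟩ : ∃ C, C ∈ xorCNF [x, y, (p, true)] :=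
      ⟨_, (mem_xorCNF _ _ _ _).2 ⟨true, true, rfl⟩⟩
    have := sub C (s1 C hC)
    rwa [vars_xor hC] at this
  have v2 : ({p, z.1, q.1} : Set ℕ) ⊆ cnfVars G := by
    obtain ⟨C, hC⟩ : ∃ C, C ∈ xorCNF [(p, true), z, q] :=
      ⟨_, (mem_xorCNF _ _ _ _).2 ⟨true, true, rfl⟩⟩
    have := sub C (s2 C hC)
    rwa [vars_xor hC] at this
  have vx : x.1 ∈ cnfVars G := v1 (by simp)
  have vy : y.1 ∈ cnfVars G := v1 (by simp)
  have vp : p ∈ cnfVars G := v1 (by simp)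
  have vz : z.1 ∈ cnfVars G := v2 (by simp)
  have vq : q.1 ∈ cnfVars G := v2 (by simp)
  have ne : ∀ u, u ∈ cnfVars G → u ≠ w := fun u hu h => hw (h ▸ hu)
  have hA : ∀ C ∈ xl x y (p, true) ++ xl (p, true) z q, C ∈ G := by
    intro C hC
    rw [List.mem_append, mem_xl, mem_xl] at hC
    exact hC.elim (s1 C) (s2 C)
  have d1 : IsERDeriv G (xl x y (p, true) ++ xl (p, true) z q) := by
    have := deriv_start (F := G) [] (xl x y (p, true) ++ xl (p, true) z q)
      (fun i hi => absurd hi (by simp)) hA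
    simpa using this
  have d2 := deriv_defs (g := xor) hw vy vz _ (xl y z (w, true)) d1
    (fun D hD hv => absurd (sub D (hA D hD) hv) hw)
    (fun C hC => defs_xor ((mem_xl _ _ _ _).1 hC))
  obtain ⟨N, a, b, c, d⟩ := deriv_ders (V := cnfVars G ∪ {w}) (xl (w, true) x q)
    (fun C hC => ders_target x y z q p w (ne _ vp) (ne _ vx) (ne _ vy) (ne _ vz) (ne _ vq) C
      ((mem_xl _ _ _ _).1 hC)) _ d2
    (fun D hD => by
      simp only [List.mem_append, mem_xl]
      tauto)
    (fun D hD => by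
      rw [List.mem_append] at hD
      rcases hD with hD | hD
      · exact (sub D (hA D hD)).trans Set.subset_union_left
      · rw [vars_xor ((mem_xl _ _ _ _).1 hD)]
        rintro u (rfl | rfl | rfl)
        · exact Or.inl vy
        · exact Or.inl vz
        · exact Or.inr rfl)
  refine ⟨w, _, hw, a, ?_, ?_, ?_⟩
  · rintro v ⟨C, hC, hv⟩
    exact d C hC hv
  · intro C hC
    rw [Finset.mem_union, ← mem_xl, ← mem_xl] at hC
    rcases hC with hC | hC
    · simp [hC]
    · exact b C hC
  · simp [xl] at c ⊢
    omega
end
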